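/- arXiv:1606.08692 — 12 statements merged into one kernel-verified Lean document; each statement's English description precedes it below -/
import Mathlib

section
/- Let Π be the transition operator of the discrete immediate exchange model IEM(1,1). Then for every α ∈ {+, −, 0} and every function f : ℕ² → ℝ, Π commutes with the operator K^{α,2}_1 + K^{α,2}_2, i.e. Π((K^{α,2}_1 + K^{α,2}_2) f) = (K^{α,2}_1 + K^{α,2}_2)(Π f) pointwise on ℕ². -/
/-- Index set for the three generators of (a discrete representation of) SU(1,1). -/
inductive SUIdx : Type
  | plus
  | minus
  | zero

/-- The operators `K^{+,κ}`, `K^{-,κ}`, `K^{0,κ}` acting on functions `ℕ → ℝ`. -/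
noncomputable def Kop : SUIdx → ℝ → (ℕ → ℝ) → ℕ → ℝ
  | .plus, κ, f, n => (κ + n) * f (n + 1)
  | .minus, _, f, n => (n : ℝ) * f (n - 1)
  | .zero, κ, f, n => (κ / 2 + n) * f n

/-- `K^{α,κ}` acting on the first variable of a two-variable function. -/
noncomputable def K1 (α : SUIdx) (κ : ℝ) (f : ℕ × ℕ → ℝ) : ℕ × ℕ → ℝ :=
  fun p => Kop α κ (fun x => f (x, p.2)) p.1

/-- `K^{α,κ}` acting on the second variable of a two-variable function. -/
noncomputable def K2 (α : SUIdx) (κ : ℝ) (f : ℕ × ℕ → ℝ) : ℕ × ℕ → ℝ :=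
  fun p => Kop α κ (fun y => f (p.1, y)) p.2

/-- The transition operator of the discrete immediate exchange model IEM(1,1):
`(Πf)(n₁,n₂) = (1/((n₁+1)(n₂+1))) ∑_{k₁=0}^{n₁} ∑_{k₂=0}^{n₂} f(k₂+n₁-k₁, k₁+n₂-k₂)`. -/
noncomputable def PiIEM11 (f : ℕ × ℕ → ℝ) : ℕ × ℕ → ℝ := fun p =>
  (1 / (((p.1 : ℝ) + 1) * ((p.2 : ℝ) + 1))) *
    ∑ k₁ ∈ Finset.range (p.1 + 1), ∑ k₂ ∈ Finset.range (p.2 + 1),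
      f (k₂ + p.1 - k₁, k₁ + p.2 - k₂)

theorem lemPlus (g : ℕ → ℕ → ℝ) (n : ℕ) :
    ∑ p ∈ Finset.HasAntidiagonal.antidiagonal n,
      ((1 + (p.1:ℝ)) * g (p.1+1) p.2 + (1 + (p.2:ℝ)) * g p.1 (p.2+1))
    = ((n:ℝ)+1) * ∑ p ∈ Finset.HasAntidiagonal.antidiagonal (n+1), g p.1 p.2 := by
  have h : ((n:ℝ)+1) * ∑ p ∈ Finset.HasAntidiagonal.antidiagonal (n+1), g p.1 p.2
      = ∑ p ∈ Finset.HasAntidiagonal.antidiagonal (n+1), (p.1:ℝ) * g p.1 p.2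
        + ∑ p ∈ Finset.HasAntidiagonal.antidiagonal (n+1), (p.2:ℝ) * g p.1 p.2 := by
    rw [Finset.mul_sum, ← Finset.sum_add_distrib]
    refine Finset.sum_congr rfl fun p hp => ?_
    have : (p.1:ℝ) + p.2 = n + 1 := by exact_mod_cast Finset.HasAntidiagonal.mem_antidiagonal.mp hp
    rw [← this]; ring
  rw [h, Finset.Nat.sum_antidiagonal_succ, Finset.Nat.sum_antidiagonal_succ',
    Finset.sum_add_distrib]
  simp [add_comm]

theorem lemMinus (g : ℕ → ℕ → ℝ) (n : ℕ) :
    ∑ p ∈ Finset.HasAntidiagonal.antidiagonal (n+1),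
      ((p.1:ℝ) * g (p.1-1) p.2 + (p.2:ℝ) * g p.1 (p.2-1))
    = ((n:ℝ)+2) * ∑ p ∈ Finset.HasAntidiagonal.antidiagonal n, g p.1 p.2 := by
  rw [Finset.sum_add_distrib, Finset.Nat.sum_antidiagonal_succ,
    Finset.Nat.sum_antidiagonal_succ', Finset.mul_sum]
  simp only [Nat.cast_zero, zero_mul, add_zero, zero_add, Nat.add_sub_cancel]
  rw [← Finset.sum_add_distrib]
  refine Finset.sum_congr rfl fun p hp => ?_
  have : (p.1:ℝ) + p.2 = n := by exact_mod_cast Finset.HasAntidiagonal.mem_antidiagonal.mp hp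
  rw [← this]; push_cast; ring

theorem lemMinus' (g : ℕ → ℕ → ℝ) (n : ℕ) :
    ∑ p ∈ Finset.HasAntidiagonal.antidiagonal n,
      ((p.1:ℝ) * g (p.1-1) p.2 + (p.2:ℝ) * g p.1 (p.2-1))
    = ((n:ℝ)+1) * (if n = 0 then 0 else ∑ p ∈ Finset.HasAntidiagonal.antidiagonal (n-1), g p.1 p.2) := by
  cases n with
  | zero => simp
  | succ n =>
    rw [lemMinus]; simp; left; ring

noncomputable def TT (f : ℕ × ℕ → ℝ) (n₁ n₂ : ℕ) : ℝ :=
  ∑ p ∈ Finset.HasAntidiagonal.antidiagonal n₁, ∑ q ∈ Finset.HasAntidiagonal.antidiagonal n₂, f (q.1 + p.2, p.1 + q.2)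

theorem Pi_eq (f : ℕ × ℕ → ℝ) (n₁ n₂ : ℕ) :
    PiIEM11 f (n₁, n₂) = (1 / (((n₁ : ℝ) + 1) * ((n₂ : ℝ) + 1))) * TT f n₁ n₂ := by
  unfold PiIEM11 TT
  simp only [Finset.Nat.sum_antidiagonal_eq_sum_range_succ_mk]
  congr 1
  refine Finset.sum_congr rfl fun i hi => Finset.sum_congr rfl fun j hj => ?_
  rw [Finset.mem_range] at hi hj
  congr 2 <;> omega

theorem pred_split (φ : ℕ → ℝ) (a b : ℕ) :
    ((a + b : ℕ) : ℝ) * φ (a + b - 1) = (a:ℝ) * φ (a - 1 + b) + (b:ℝ) * φ (a + (b - 1)) := by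
  rcases a with _ | a <;> rcases b with _ | b
  · simp
  · simp
  · simp
  · have h1 : a + 1 + (b + 1) - 1 = a + b + 1 := by omega
    have h2 : a + 1 - 1 + (b + 1) = a + b + 1 := by omega
    have h3 : a + 1 + (b + 1 - 1) = a + b + 1 := by omega
    rw [h1, h2, h3]; push_cast; ring

theorem TT_split (F : ℕ × ℕ → ℝ) (A B : ℕ × ℕ → ℕ × ℕ → ℝ) (n₁ n₂ : ℕ)
    (h : ∀ p q : ℕ × ℕ, F (q.1 + p.2, p.1 + q.2) = A p q + B p q) :
    TT F n₁ n₂ = ∑ q ∈ Finset.HasAntidiagonal.antidiagonal n₂, ∑ p ∈ Finset.HasAntidiagonal.antidiagonal n₁, A p q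
      + ∑ p ∈ Finset.HasAntidiagonal.antidiagonal n₁, ∑ q ∈ Finset.HasAntidiagonal.antidiagonal n₂, B p q := by
  unfold TT
  simp only [h, Finset.sum_add_distrib]
  rw [Finset.sum_comm]

theorem IEM11_commutes_with_K2_symmetries (α : SUIdx) (f : ℕ × ℕ → ℝ) (n₁ n₂ : ℕ) :
    PiIEM11 (fun p => K1 α 2 f p + K2 α 2 f p) (n₁, n₂)
      = K1 α 2 (PiIEM11 f) (n₁, n₂) + K2 α 2 (PiIEM11 f) (n₁, n₂) := by
  have e1 : (n₁:ℝ) + 1 ≠ 0 := by positivity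
  have e2 : (n₂:ℝ) + 1 ≠ 0 := by positivity
  cases α with
  | plus =>
    simp only [K1, K2, Kop, Pi_eq]
    rw [TT_split _
      (fun p q => (1 + (p.1:ℝ)) * f (q.1 + p.2, (p.1 + 1) + q.2)
        + (1 + (p.2:ℝ)) * f (q.1 + (p.2+1), p.1 + q.2))
      (fun p q => (1 + (q.1:ℝ)) * f ((q.1 + 1) + p.2, p.1 + q.2)
        + (1 + (q.2:ℝ)) * f (q.1 + p.2, p.1 + (q.2 + 1)))]
    · have hA : ∀ q : ℕ × ℕ, _ := fun q =>
        lemPlus (fun a b => f (q.1 + b, a + q.2)) n₁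
      have hB : ∀ p : ℕ × ℕ, _ := fun p =>
        lemPlus (fun a b => f (a + p.2, p.1 + b)) n₂
      simp only [hA, hB, ← Finset.mul_sum]
      rw [Finset.sum_comm]
      change _ * (_ * TT f (n₁+1) n₂ + _ * TT f n₁ (n₂+1)) = _
      have e3 : (n₁:ℝ) + 1 + 1 ≠ 0 := by positivity
      have e4 : (n₂:ℝ) + 1 + 1 ≠ 0 := by positivity
      push_cast
      field_simp
      ring
    · intro p q
      have h1 : q.1 + p.2 + 1 = q.1 + (p.2 + 1) := by omega
      have h2 : q.1 + 1 + p.2 = q.1 + (p.2 + 1) := by omega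
      have h3 : p.1 + q.2 + 1 = p.1 + (q.2 + 1) := by omega
      have h4 : p.1 + 1 + q.2 = p.1 + (q.2 + 1) := by omega
      simp only [h1, h2, h3, h4]; push_cast; ring
  | minus =>
    simp only [K1, K2, Kop, Pi_eq]
    rw [TT_split _
      (fun p q => (p.1:ℝ) * f (q.1 + p.2, (p.1 - 1) + q.2)
        + (p.2:ℝ) * f (q.1 + (p.2-1), p.1 + q.2))
      (fun p q => (q.1:ℝ) * f ((q.1 - 1) + p.2, p.1 + q.2)
        + (q.2:ℝ) * f (q.1 + p.2, p.1 + (q.2 - 1)))]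
    · have hA : ∀ q : ℕ × ℕ, _ := fun q =>
        lemMinus' (fun a b => f (q.1 + b, a + q.2)) n₁
      have hB : ∀ p : ℕ × ℕ, _ := fun p =>
        lemMinus' (fun a b => f (a + p.2, p.1 + b)) n₂
      simp only [hA, hB, ← Finset.mul_sum]
      have hX : ∑ q ∈ Finset.HasAntidiagonal.antidiagonal n₂, (if n₁ = 0 then (0:ℝ) else
          ∑ p ∈ Finset.HasAntidiagonal.antidiagonal (n₁-1), f (q.1 + p.2, p.1 + q.2))
          = if n₁ = 0 then 0 else TT f (n₁-1) n₂ := by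
        split_ifs
        · simp
        · rw [Finset.sum_comm]; rfl
      have hY : ∑ p ∈ Finset.HasAntidiagonal.antidiagonal n₁, (if n₂ = 0 then (0:ℝ) else
          ∑ q ∈ Finset.HasAntidiagonal.antidiagonal (n₂-1), f (q.1 + p.2, p.1 + q.2))
          = if n₂ = 0 then 0 else TT f n₁ (n₂-1) := by
        split_ifs
        · simp
        · rfl
      rw [hX, hY, mul_add]
      congr 1
      · rcases n₁ with _ | m
        · simp
        · have : (m:ℝ) + 1 ≠ 0 := by positivity
          simp only [Nat.add_sub_cancel, Nat.add_eq_zero_iff, one_ne_zero, and_false, if_false]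
          field_simp
          push_cast
          ring
      · rcases n₂ with _ | m
        · simp
        · have : (m:ℝ) + 1 ≠ 0 := by positivity
          simp only [Nat.add_sub_cancel, Nat.add_eq_zero_iff, one_ne_zero, and_false, if_false]
          field_simp
          push_cast
          ring
    · intro p q
      have h1 := pred_split (fun x => f (x, p.1 + q.2)) q.1 p.2
      have h2 := pred_split (fun x => f (q.1 + p.2, x)) p.1 q.2
      simp only at h1 h2 ⊢
      rw [h1, h2]; ring
  | zero =>
    simp only [K1, K2, Kop, Pi_eq]
    have : TT (fun p => (2 / 2 + (p.1:ℝ)) * f (p.1, p.2) + (2 / 2 + (p.2:ℝ)) * f (p.1, p.2)) n₁ n₂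
        = ((n₁:ℝ) + n₂ + 2) * TT f n₁ n₂ := by
      unfold TT
      simp only [Finset.mul_sum]
      refine Finset.sum_congr rfl fun p hp => Finset.sum_congr rfl fun q hq => ?_
      have h1 : (p.1:ℝ) + p.2 = n₁ := by exact_mod_cast Finset.HasAntidiagonal.mem_antidiagonal.mp hp
      have h2 : (q.1:ℝ) + q.2 = n₂ := by exact_mod_cast Finset.HasAntidiagonal.mem_antidiagonal.mp hq
      rw [← h1, ← h2]; push_cast; ring
    rw [this]; ring
end

section
/- The transition operator Π of the discrete immediate exchange model IEM(1,1) is self-dual with self-duality function D(k₁,k₂;n₁,n₂) = d(k₁,n₁)·d(k₂,n₂), where d(k,n) = n!/((n−k)!·(k+1)!) if k ≤ n and d(k,n) = 0 if k > n. -/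
/-- Self-duality of a transition operator on functions `ℕ² → ℝ` with respect to
a duality function `D`. -/
def IsSelfDual (T : (ℕ × ℕ → ℝ) → (ℕ × ℕ → ℝ)) (D : ℕ × ℕ → ℕ × ℕ → ℝ) : Prop :=
  ∀ k n : ℕ × ℕ, T (fun m => D m n) k = T (fun m => D k m) n

/-- The single-site self-duality function `d(k,n) = n!/((n-k)!·(k+1)!)` for `k ≤ n`,
and `0` for `k > n`. -/
noncomputable def d11 (k n : ℕ) : ℝ :=
  if k ≤ n then (n.factorial : ℝ) / ((n - k).factorial * (k + 1).factorial) else 0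

open Finset in
lemma iem_aux_zero (n q : ℕ) :
    ∑ j ∈ range (n + 1), j.choose q = (n + 1).choose (q + 1) := by
  induction n with
  | zero => cases q <;> simp [Nat.choose_eq_zero_of_lt]
  | succ n ih =>
    rw [sum_range_succ, ih, Nat.choose_succ_succ (n + 1) q, add_comm]

open Finset in
lemma iem_aux (n : ℕ) : ∀ p q : ℕ,
    ∑ ij ∈ antidiagonal n, ij.1.choose p * ij.2.choose q = (n + 1).choose (p + q + 1) := by
  have h0 : ∀ n q : ℕ, ∑ ij ∈ antidiagonal n, ij.1.choose 0 * ij.2.choose q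
      = (n + 1).choose (0 + q + 1) := by
    intro n q
    rw [← Finset.Nat.sum_antidiagonal_swap, Finset.Nat.sum_antidiagonal_eq_sum_range_succ_mk]
    simpa using iem_aux_zero n q
  induction n with
  | zero =>
    intro p q
    cases p with
    | zero => exact h0 0 q
    | succ p => simp [Nat.choose_eq_zero_of_lt]
  | succ n ih =>
    intro p q
    cases p with
    | zero => exact h0 _ q
    | succ p =>
      rw [Finset.Nat.sum_antidiagonal_succ]
      simp only [Nat.choose_succ_succ _ p, add_mul, sum_add_distrib, Nat.choose_zero_succ, zero_mul,
        zero_add]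
      rw [ih p q, ih (p + 1) q, Nat.choose_succ_succ (n + 1) (p + 1 + q)]
      congr 2
      ring

open Finset in
lemma iem_aux' (n p q : ℕ) :
    ∑ j ∈ range (n + 1), (n - j).choose p * j.choose q = (n + 1).choose (p + q + 1) := by
  rw [← iem_aux, ← Finset.Nat.sum_antidiagonal_swap, Finset.Nat.sum_antidiagonal_eq_sum_range_succ_mk]
  rfl

open Finset in
lemma iem_vander (a b k : ℕ) :
    (a + b).choose k = ∑ r ∈ range (k + 1), a.choose (k - r) * b.choose r := by
  rw [Nat.add_choose_eq, ← Finset.Nat.sum_antidiagonal_swap,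
    Finset.Nat.sum_antidiagonal_eq_sum_range_succ_mk]
  rfl

open Finset in
lemma iem_main (k₁ k₂ n₁ n₂ : ℕ) :
    ∑ i ∈ range (k₁ + 1), ∑ j ∈ range (k₂ + 1),
      (n₁ + 1).choose (j + k₁ - i + 1) * (n₂ + 1).choose (i + k₂ - j + 1) =
    ∑ i ∈ range (n₁ + 1), ∑ j ∈ range (n₂ + 1),
      (j + n₁ - i).choose k₁ * (i + n₂ - j).choose k₂ := by
  have hR : ∀ i ∈ range (n₁ + 1), ∀ j ∈ range (n₂ + 1),
      (j + n₁ - i).choose k₁ * (i + n₂ - j).choose k₂ =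
      ∑ r ∈ range (k₁ + 1), ∑ q ∈ range (k₂ + 1),
        ((n₁ - i).choose (k₁ - r) * i.choose q) * ((n₂ - j).choose (k₂ - q) * j.choose r) := by
    intro i hi j hj
    simp only [mem_range] at hi hj
    rw [show j + n₁ - i = (n₁ - i) + j by omega, show i + n₂ - j = (n₂ - j) + i by omega,
      iem_vander, iem_vander (n₂ - j), sum_mul_sum]
    refine sum_congr rfl fun r _ => sum_congr rfl fun q _ => by ring
  rw [sum_congr rfl fun i hi => sum_congr rfl fun j hj => hR i hi j hj]
  have hL : ∀ r ∈ range (k₁ + 1), ∀ q ∈ range (k₂ + 1),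
      (n₁ + 1).choose (q + k₁ - r + 1) * (n₂ + 1).choose (r + k₂ - q + 1) =
      ∑ i ∈ range (n₁ + 1), ∑ j ∈ range (n₂ + 1),
        ((n₁ - i).choose (k₁ - r) * i.choose q) * ((n₂ - j).choose (k₂ - q) * j.choose r) := by
    intro r hr q hq
    simp only [mem_range] at hr hq
    rw [← sum_mul_sum, iem_aux', iem_aux']
    congr 2 <;> omega
  rw [sum_congr rfl fun i hi => sum_congr rfl fun j hj => hL i hi j hj]
  have e : ∀ (A B C D : Finset ℕ) (F : ℕ → ℕ → ℕ → ℕ → ℕ),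
      ∑ r ∈ A, ∑ q ∈ B, ∑ i ∈ C, ∑ j ∈ D, F r q i j =
      ∑ i ∈ C, ∑ j ∈ D, ∑ r ∈ A, ∑ q ∈ B, F r q i j := by
    intro A B C D F
    rw [← sum_product' A B (fun r q => ∑ i ∈ C, ∑ j ∈ D, F r q i j), sum_comm]
    refine sum_congr rfl fun i _ => ?_
    rw [sum_comm]
    refine sum_congr rfl fun j _ => ?_
    rw [← sum_product' A B (fun r q => F r q i j)]
  exact e _ _ _ _ fun r q i j =>
    ((n₁ - i).choose (k₁ - r) * i.choose q) * ((n₂ - j).choose (k₂ - q) * j.choose r)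

lemma d11_eq (k n : ℕ) : d11 k n = (n.choose k : ℝ) / (k + 1) := by
  unfold d11
  split_ifs with h
  · rw [Nat.cast_choose ℝ h, Nat.factorial_succ]
    have := Nat.factorial_ne_zero k
    have := Nat.factorial_ne_zero (n - k)
    push_cast
    field_simp
  · rw [Nat.choose_eq_zero_of_lt (by omega)]; simp

lemma d11_eq' (k n : ℕ) : d11 k n = ((n + 1).choose (k + 1) : ℝ) / (n + 1) := by
  rw [d11_eq, div_eq_div_iff (by positivity) (by positivity)]
  have := Nat.add_one_mul_choose_eq n k
  have h : ((n + 1 : ℕ) : ℝ) * (n.choose k : ℝ) = ((n + 1).choose (k + 1) : ℝ) * ((k + 1 : ℕ) : ℝ) := by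
    exact_mod_cast this
  push_cast at h
  linarith

/-- The discrete immediate exchange model IEM(1,1) is self-dual with
self-duality function `D(k₁,k₂;n₁,n₂) = d(k₁,n₁)·d(k₂,n₂)`. -/
theorem IEM11_selfDual :
    IsSelfDual PiIEM11 (fun k n => d11 k.1 n.1 * d11 k.2 n.2) := by
  rintro ⟨k₁, k₂⟩ ⟨n₁, n₂⟩
  have h : ((_ : ℕ) : ℝ) = ((_ : ℕ) : ℝ) := congrArg _ (iem_main k₁ k₂ n₁ n₂)
  push_cast at h
  simp only [PiIEM11]
  simp only [d11_eq' _ n₁, d11_eq' _ n₂, d11_eq k₁, d11_eq k₂, div_mul_div_comm,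
    ← Finset.sum_div]
  rw [h]
  field_simp
end

section
/- Let μ : ℕ⁴ → (0,∞) be a summable weight that is invariant under the exchange map, i.e. μ(a,b,c,d) = μ(c,b,a,d) for all a,b,c,d ∈ ℕ, and let P be a linear operator mapping bounded functions ℕ⁴ → ℝ to bounded functions which is reversible with respect to μ, i.e. ∑_{ℕ⁴} (Pf)·g·μ = ∑_{ℕ⁴} f·(Pg)·μ for all bounded f, g : ℕ⁴ → ℝ. Assume moreover that T_φ⁻¹ P ℰ T_φ = T_φ⁻¹ ℰ P T_φ as operators on bounded functions ℕ² → ℝ, where T_φ⁻¹ is μ-canonical. Then the image weight μ̃ = μ ∘ φ is reversible for Π := T_φ⁻¹ P ℰ T_φ, i.e. ∑_{ℕ²} (Πf)·g·μ̃ = ∑_{ℕ²} f·(Πg)·μ̃ for all bounded f, g : ℕ² → ℝ. -/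
/-- A function to `ℝ` is bounded. -/
def Bounded {X : Type*} (f : X → ℝ) : Prop := ∃ C : ℝ, ∀ x : X, |f x| ≤ C

/-- The lumping operator `T_φ`, sending `f : ℕ² → ℝ` to
`(a,b,c,d) ↦ f(a+b, c+d)`. -/
def Tphi (f : ℕ × ℕ → ℝ) : ℕ × ℕ × ℕ × ℕ → ℝ :=
  fun x => f (x.1 + x.2.1, x.2.2.1 + x.2.2.2)

/-- The exchange operator `ℰ`, `(ℰf)(a,b,c,d) = f(c,b,a,d)`. -/
def Exch (f : ℕ × ℕ × ℕ × ℕ → ℝ) : ℕ × ℕ × ℕ × ℕ → ℝ :=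
  fun x => f (x.2.2.1, x.2.1, x.1, x.2.2.2)

/-- The image weight `μ̃(n₁,n₂) = ∑_{a+b=n₁, c+d=n₂} μ(a,b,c,d)` of a weight `μ` on `ℕ⁴`
under the map `φ(a,b,c,d) = (a+b, c+d)`. -/
noncomputable def imageWeight (μ : ℕ × ℕ × ℕ × ℕ → ℝ) (n : ℕ × ℕ) : ℝ :=
  ∑ a ∈ Finset.range (n.1 + 1), ∑ c ∈ Finset.range (n.2 + 1),
    μ (a, n.1 - a, c, n.2 - c)

/-- The `μ`-canonical inverse `T_φ⁻¹` of the lumping operator: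
`(T_φ⁻¹f)(n₁,n₂) = ∑_{a+b=n₁, c+d=n₂} f(a,b,c,d)·μ(a,b,c,d)/μ̃(n₁,n₂)`. -/
noncomputable def TphiInv (μ : ℕ × ℕ × ℕ × ℕ → ℝ) (f : ℕ × ℕ × ℕ × ℕ → ℝ) :
    ℕ × ℕ → ℝ := fun n =>
  ∑ a ∈ Finset.range (n.1 + 1), ∑ c ∈ Finset.range (n.2 + 1),
    f (a, n.1 - a, c, n.2 - c) * μ (a, n.1 - a, c, n.2 - c) / imageWeight μ n

theorem aux_mul {X : Type*} {f g : X → ℝ} (hf : Bounded f) (hg : Bounded g) :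
    Bounded (fun x => f x * g x) := by
  obtain ⟨C, hC⟩ := hf
  obtain ⟨D, hD⟩ := hg
  refine ⟨C * D, fun x => ?_⟩
  rw [abs_mul]
  exact mul_le_mul (hC x) (hD x) (abs_nonneg _) ((abs_nonneg _).trans (hC x))

theorem aux_summable {X : Type*} {f μ : X → ℝ} (hf : Bounded f) (hpos : ∀ x, 0 < μ x)
    (hs : Summable μ) : Summable (fun x => f x * μ x) := by
  obtain ⟨C, hC⟩ := hf
  refine Summable.of_norm_bounded (hs.mul_left C) fun x => ?_
  rw [Real.norm_eq_abs, abs_mul, abs_of_pos (hpos x)]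
  exact mul_le_mul_of_nonneg_right (hC x) (hpos x).le

theorem aux_fiber (F : ℕ × ℕ × ℕ × ℕ → ℝ) (hF : Summable F) :
    ∑' x, F x = ∑' n : ℕ × ℕ, ∑ a ∈ Finset.range (n.1 + 1), ∑ c ∈ Finset.range (n.2 + 1),
      F (a, n.1 - a, c, n.2 - c) := by
  have h := hF.hasSum.tsum_fiberwise
    (fun x : ℕ × ℕ × ℕ × ℕ => (x.1 + x.2.1, x.2.2.1 + x.2.2.2))
  rw [← h.tsum_eq]
  refine tsum_congr fun n => ?_
  have hS : ((fun x : ℕ × ℕ × ℕ × ℕ => (x.1 + x.2.1, x.2.2.1 + x.2.2.2)) ⁻¹' {n}) =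
      (((Finset.range (n.1 + 1) ×ˢ Finset.range (n.2 + 1)).image
        (fun p : ℕ × ℕ => (p.1, n.1 - p.1, p.2, n.2 - p.2)) :
          Finset (ℕ × ℕ × ℕ × ℕ)) : Set (ℕ × ℕ × ℕ × ℕ)) := by
    ext ⟨a, b, c, d⟩
    obtain ⟨m, k⟩ := n
    simp only [Set.mem_preimage, Set.mem_singleton_iff, Prod.mk.injEq, Finset.coe_image,
      Set.mem_image, Finset.mem_coe, Finset.mem_product, Finset.mem_range, Prod.exists]
    constructor
    · rintro ⟨h1, h2⟩
      exact ⟨a, c, by omega, by omega⟩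
    · rintro ⟨a', c', h1, h2⟩
      omega
  rw [hS, Finset.tsum_subtype', Finset.sum_image, Finset.sum_product]
  rintro ⟨a, c⟩ _ ⟨a', c'⟩ _ h
  simp only [Prod.mk.injEq] at h ⊢
  exact ⟨h.1, h.2.2.1⟩

theorem aux_main (μ : ℕ × ℕ × ℕ × ℕ → ℝ) (hμpos : ∀ x, 0 < μ x) (hμsum : Summable μ)
    (h : ℕ × ℕ × ℕ × ℕ → ℝ) (g : ℕ × ℕ → ℝ) (hh : Bounded h) (hg : Bounded g) :
    ∑' n : ℕ × ℕ, TphiInv μ h n * g n * imageWeight μ n = ∑' x, h x * Tphi g x * μ x := by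
  have hT : Bounded (Tphi g) := hg.imp fun C hC x => hC _
  rw [aux_fiber _ (aux_summable (aux_mul hh hT) hμpos hμsum)]
  refine tsum_congr fun n => ?_
  have hw : imageWeight μ n ≠ 0 := by
    refine ne_of_gt (Finset.sum_pos (fun a _ => Finset.sum_pos (fun c _ => hμpos _) ?_) ?_) <;>
      simp
  unfold TphiInv
  rw [Finset.sum_mul, Finset.sum_mul]
  refine Finset.sum_congr rfl fun a ha => ?_
  rw [Finset.sum_mul, Finset.sum_mul]
  refine Finset.sum_congr rfl fun c hc => ?_
  have h1 : a + (n.1 - a) = n.1 := by have := Finset.mem_range.1 ha; omega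
  have h2 : c + (n.2 - c) = n.2 := by have := Finset.mem_range.1 hc; omega
  simp only [Tphi, h1, h2]
  field_simp

def auxSwap : (ℕ × ℕ × ℕ × ℕ) ≃ (ℕ × ℕ × ℕ × ℕ) where
  toFun x := (x.2.2.1, x.2.1, x.1, x.2.2.2)
  invFun x := (x.2.2.1, x.2.1, x.1, x.2.2.2)
  left_inv _ := rfl
  right_inv _ := rfl

/-- If `μ` is a strictly positive summable weight on `ℕ⁴`, invariant under the exchange map
and reversible for a linear operator `P` preserving boundedness, and if
`T_φ⁻¹ P ℰ T_φ = T_φ⁻¹ ℰ P T_φ` with `T_φ⁻¹` the `μ`-canonical inverse,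
then the image weight `μ̃ = μ ∘ φ` is reversible for `Π := T_φ⁻¹ P ℰ T_φ`. -/
theorem imageWeight_reversible_for_Pi
    (μ : ℕ × ℕ × ℕ × ℕ → ℝ) (hμpos : ∀ x, 0 < μ x) (hμsum : Summable μ)
    (hμexch : ∀ a b c d : ℕ, μ (a, b, c, d) = μ (c, b, a, d))
    (P : (ℕ × ℕ × ℕ × ℕ → ℝ) → (ℕ × ℕ × ℕ × ℕ → ℝ))
    (hPlin : ∀ (a b : ℝ) (f g : ℕ × ℕ × ℕ × ℕ → ℝ),
      P (fun x => a * f x + b * g x) = fun x => a * P f x + b * P g x)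
    (hPbdd : ∀ f : ℕ × ℕ × ℕ × ℕ → ℝ, Bounded f → Bounded (P f))
    (hPrev : ∀ f g : ℕ × ℕ × ℕ × ℕ → ℝ, Bounded f → Bounded g →
      ∑' x : ℕ × ℕ × ℕ × ℕ, P f x * g x * μ x = ∑' x : ℕ × ℕ × ℕ × ℕ, f x * P g x * μ x)
    (hcomm : ∀ f : ℕ × ℕ → ℝ, Bounded f →
      TphiInv μ (P (Exch (Tphi f))) = TphiInv μ (Exch (P (Tphi f))))
    (f g : ℕ × ℕ → ℝ) (hf : Bounded f) (hg : Bounded g) :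
    ∑' n : ℕ × ℕ, TphiInv μ (P (Exch (Tphi f))) n * g n * imageWeight μ n
      = ∑' n : ℕ × ℕ, f n * TphiInv μ (P (Exch (Tphi g))) n * imageWeight μ n := by
  have bT : ∀ {u}, Bounded u → Bounded (Tphi u) := fun hu => hu.imp fun C hC x => hC _
  have bE : ∀ {u}, Bounded u → Bounded (Exch u) := fun hu => hu.imp fun C hC x => hC _
  rw [aux_main μ hμpos hμsum _ g (hPbdd _ (bE (bT hf))) hg, hPrev _ _ (bE (bT hf)) (bT hg),
    hcomm g hg]
  have e : ∀ n, f n * TphiInv μ (Exch (P (Tphi g))) n * imageWeight μ n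
      = TphiInv μ (Exch (P (Tphi g))) n * f n * imageWeight μ n := fun n => by ring
  rw [tsum_congr e, aux_main μ hμpos hμsum _ f (bE (hPbdd _ (bT hg))) hf,
    ← auxSwap.tsum_eq]
  refine tsum_congr fun x => ?_
  have hm : μ (auxSwap x) = μ x := (hμexch _ _ _ _).symm
  rw [hm, mul_comm (Exch (Tphi f) _)]
  rfl
end

section
/- Let κ₁, κ₂ > 0 and let 𝒜 be the lumping operator sending f : ℕ → ℝ to (𝒜f)(n,m) = f(n+m). Then for every α ∈ {+, −, 0}, every f : ℕ → ℝ and all n₁, n₂ ∈ ℕ, ((K^{α,κ₁}_1 + K^{α,κ₂}_2)(𝒜f))(n₁,n₂) = (K^{α,κ₁+κ₂}f)(n₁+n₂); that is, (K^{α,κ₁}_1 + K^{α,κ₂}_2) ∘ 𝒜 = 𝒜 ∘ K^{α,κ₁+κ₂}. -/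
/-- The lumping operator `𝒜`, sending `f : ℕ → ℝ` to `(n,m) ↦ f(n+m)`. -/
def lump (f : ℕ → ℝ) : ℕ × ℕ → ℝ := fun p => f (p.1 + p.2)

/-- Additive structure of the symmetries: for `κ₁, κ₂ > 0` and `α ∈ {+,-,0}`,
`(K^{α,κ₁}_1 + K^{α,κ₂}_2) ∘ 𝒜 = 𝒜 ∘ K^{α,κ₁+κ₂}`. -/
theorem K_additive_structure (κ₁ κ₂ : ℝ) (hκ₁ : 0 < κ₁) (hκ₂ : 0 < κ₂)
    (α : SUIdx) (f : ℕ → ℝ) (n₁ n₂ : ℕ) :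
    K1 α κ₁ (lump f) (n₁, n₂) + K2 α κ₂ (lump f) (n₁, n₂)
      = Kop α (κ₁ + κ₂) f (n₁ + n₂) := by
  cases α with
  | plus =>
    simp only [K1, K2, Kop, lump]
    rw [show n₁ + 1 + n₂ = n₁ + n₂ + 1 by omega, show n₁ + (n₂ + 1) = n₁ + n₂ + 1 by omega]
    push_cast
    ring
  | minus =>
    simp only [K1, K2, Kop, lump]
    have h1 : (n₁ : ℝ) * f (n₁ - 1 + n₂) = n₁ * f (n₁ + n₂ - 1) := by
      rcases Nat.eq_zero_or_pos n₁ with h | h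
      · simp [h]
      · rw [show n₁ - 1 + n₂ = n₁ + n₂ - 1 by omega]
    have h2 : (n₂ : ℝ) * f (n₁ + (n₂ - 1)) = n₂ * f (n₁ + n₂ - 1) := by
      rcases Nat.eq_zero_or_pos n₂ with h | h
      · simp [h]
      · rw [show n₁ + (n₂ - 1) = n₁ + n₂ - 1 by omega]
    rw [h1, h2]
    push_cast
    ring
  | zero =>
    simp only [K1, K2, Kop, lump]
    push_cast
    ring
end

section
/- For all s, t > 0 and every α ∈ {+, −, 0}, the generator L^{SIP(s,t)} of the inclusion process SIP(s,t) on two sites commutes with K^{α,s}_1 + K^{α,t}_2; that is, L^{SIP(s,t)}((K^{α,s}_1 + K^{α,t}_2)f) = (K^{α,s}_1 + K^{α,t}_2)(L^{SIP(s,t)}f) for every f : ℕ² → ℝ. -/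
/-- The generator of the inclusion process SIP(s,t) on two sites:
`(Lf)(n,m) = n(t+m)(f(n-1,m+1)-f(n,m)) + m(s+n)(f(n+1,m-1)-f(n,m))`. -/
noncomputable def LSIP (s t : ℝ) (f : ℕ × ℕ → ℝ) : ℕ × ℕ → ℝ := fun p =>
  (p.1 : ℝ) * (t + p.2) * (f (p.1 - 1, p.2 + 1) - f p)
    + (p.2 : ℝ) * (s + p.1) * (f (p.1 + 1, p.2 - 1) - f p)

/-- For all `s, t > 0` and `α ∈ {+,-,0}`, the generator of SIP(s,t) commutes with
`K^{α,s}_1 + K^{α,t}_2`. -/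
theorem LSIP_commutes_with_K (s t : ℝ) (hs : 0 < s) (ht : 0 < t)
    (α : SUIdx) (f : ℕ × ℕ → ℝ) (p : ℕ × ℕ) :
    LSIP s t (fun q => K1 α s f q + K2 α t f q) p
      = K1 α s (LSIP s t f) p + K2 α t (LSIP s t f) p := by
  obtain ⟨n, m⟩ := p
  cases α <;> rcases n with _ | _ | n <;> rcases m with _ | _ | m <;>
    simp [LSIP, K1, K2, Kop] <;> ring_nf
end

section
/- For all s, t > 0 and N ∈ ℕ, the Beta-Binomial distribution with parameters N, s, t satisfies the detailed balance relation for the two-site inclusion process SIP(s,t) restricted to configurations of total mass N: for every 1 ≤ k ≤ N, bb(k;N,s,t) · k·(t+N−k) = bb(k−1;N,s,t) · (N−k+1)·(s+k−1). Consequently the Beta-Binomial distribution on {0,…,N} is reversible for the SIP(s,t) dynamics on {(k, N−k) : 0 ≤ k ≤ N}. -/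
/-- The Beta function `B(x,y) = Γ(x)Γ(y)/Γ(x+y)`. -/
noncomputable def betaFn (x y : ℝ) : ℝ := Real.Gamma x * Real.Gamma y / Real.Gamma (x + y)

/-- The Beta-Binomial weight `bb(k;n,s,t) = C(n,k)·B(k+s, n-k+t)/B(s,t)`. -/
noncomputable def bb (k n : ℕ) (s t : ℝ) : ℝ :=
  (n.choose k : ℝ) * betaFn ((k : ℝ) + s) (((n - k : ℕ) : ℝ) + t) / betaFn s t

/-- The generator of the two-site SIP(s,t) restricted to configurations `(k, N-k)` of total
mass `N`: `(Lf)(k) = k(t+N-k)(f(k-1)-f(k)) + (N-k)(s+k)(f(k+1)-f(k))`. -/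
noncomputable def LSIPN (s t : ℝ) (N : ℕ) (f : ℕ → ℝ) (k : ℕ) : ℝ :=
  (k : ℝ) * (t + ((N - k : ℕ) : ℝ)) * (f (k - 1) - f k)
    + ((N - k : ℕ) : ℝ) * (s + k) * (f (k + 1) - f k)

theorem bb_db_aux (s t : ℝ) (hs : 0 < s) (ht : 0 < t) (N k : ℕ) (h1 : 1 ≤ k) (hk : k ≤ N) :
    bb k N s t * ((k : ℝ) * (t + ((N - k : ℕ) : ℝ)))
        = bb (k - 1) N s t * ((((N - k : ℕ) : ℝ) + 1) * (s + (k : ℝ) - 1)) := by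
  obtain ⟨j, rfl⟩ : ∃ j, k = j + 1 := ⟨k - 1, by omega⟩
  obtain ⟨m, rfl⟩ : ∃ m, N = j + 1 + m := ⟨N - (j + 1), by omega⟩
  have e1 : j + 1 + m - (j + 1) = m := by omega
  have e2 : j + 1 + m - j = m + 1 := by omega
  have hc : ((j + 1 + m).choose (j + 1) : ℝ) * ((j : ℝ) + 1)
      = ((j + 1 + m).choose j : ℝ) * ((m : ℝ) + 1) := by
    have := Nat.choose_succ_right_eq (j + 1 + m) j
    rw [e2] at this
    exact_mod_cast this
  have g1 : Real.Gamma ((j : ℝ) + 1 + s) = ((j : ℝ) + s) * Real.Gamma ((j : ℝ) + s) := by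
    rw [← Real.Gamma_add_one (by positivity)]
    congr 1; ring
  have g2 : Real.Gamma ((m : ℝ) + 1 + t) = ((m : ℝ) + t) * Real.Gamma ((m : ℝ) + t) := by
    rw [← Real.Gamma_add_one (by positivity)]
    congr 1; ring
  have g3 : (j : ℝ) + 1 + s + (m + t) = j + s + (m + 1 + t) := by ring
  simp only [bb, betaFn, Nat.add_sub_cancel, e1, e2]
  push_cast
  rw [g3, g1, g2]
  linear_combination ((j : ℝ) + s) * Real.Gamma ((j : ℝ) + s) * Real.Gamma ((m : ℝ) + t)
    / Real.Gamma (j + s + (m + 1 + t)) / (Real.Gamma s * Real.Gamma t / Real.Gamma (s + t))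
    * (t + m) * hc

/-- For `s, t > 0` and `N ∈ ℕ`, the Beta-Binomial distribution with parameters `N, s, t`
satisfies detailed balance for the two-site SIP(s,t) at total mass `N`:
for `1 ≤ k ≤ N`, `bb(k;N,s,t)·k·(t+N-k) = bb(k-1;N,s,t)·(N-k+1)·(s+k-1)`.
Consequently the Beta-Binomial distribution is reversible for the SIP(s,t) dynamics on
`{(k, N-k) : 0 ≤ k ≤ N}`. -/
theorem betaBinomial_detailed_balance (s t : ℝ) (hs : 0 < s) (ht : 0 < t) (N : ℕ) :
    (∀ k : ℕ, 1 ≤ k → k ≤ N →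
      bb k N s t * ((k : ℝ) * (t + ((N - k : ℕ) : ℝ)))
        = bb (k - 1) N s t * ((((N - k : ℕ) : ℝ) + 1) * (s + (k : ℝ) - 1))) ∧
    (∀ f g : ℕ → ℝ,
      ∑ k ∈ Finset.range (N + 1), bb k N s t * LSIPN s t N f k * g k
        = ∑ k ∈ Finset.range (N + 1), bb k N s t * f k * LSIPN s t N g k) := by
  refine ⟨fun k h1 hk => bb_db_aux s t hs ht N k h1 hk, fun f g => ?_⟩
  have key : ∀ n : ℕ, n ≤ N →
      ∑ k ∈ Finset.range (n + 1),
        (bb k N s t * LSIPN s t N f k * g k - bb k N s t * f k * LSIPN s t N g k)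
      = bb n N s t * (((N - n : ℕ) : ℝ) * (s + n)) * (f (n + 1) * g n - f n * g (n + 1)) := by
    intro n
    induction n with
    | zero =>
      intro _
      simp [LSIPN]
      ring
    | succ n ih =>
      intro hn
      rw [Finset.sum_range_succ, ih (by omega)]
      have h := bb_db_aux s t hs ht N (n + 1) (by omega) hn
      have e : ((N - n : ℕ) : ℝ) = ((N - (n + 1) : ℕ) : ℝ) + 1 := by
        have : N - n = N - (n + 1) + 1 := by omega
        exact_mod_cast this
      simp only [LSIPN, Nat.add_sub_cancel] at h ⊢
      rw [e]
      push_cast at h ⊢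
      linear_combination (f n * g (n + 1) - f (n + 1) * g n) * h
  have h := key N le_rfl
  rw [Finset.sum_sub_distrib] at h
  simp only [Nat.sub_self, Nat.cast_zero, zero_mul, mul_zero] at h
  linarith
end

section
/- Let s, t₁, t₂ > 0 and let Π be the transition operator of the generalized immediate exchange model IEM(s,t₁;s,t₂). Then for every α ∈ {+, −, 0} and every f : ℕ² → ℝ, Π commutes with K^{α,s+t₁}_1 + K^{α,s+t₂}_2, i.e. Π((K^{α,s+t₁}_1 + K^{α,s+t₂}_2)f) = (K^{α,s+t₁}_1 + K^{α,s+t₂}_2)(Πf) pointwise on ℕ². -/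
/-- The transition operator of the generalized immediate exchange model IEM(s,t₁;s,t₂):
`(Πf)(n₁,n₂) = ∑_{k₁=0}^{n₁} ∑_{k₂=0}^{n₂} bb(k₁;n₁,s,t₁)·bb(k₂;n₂,s,t₂)·f(k₂+n₁-k₁, k₁+n₂-k₂)`. -/
noncomputable def PiIEM (s t₁ t₂ : ℝ) (f : ℕ × ℕ → ℝ) : ℕ × ℕ → ℝ := fun p =>
  ∑ k₁ ∈ Finset.range (p.1 + 1), ∑ k₂ ∈ Finset.range (p.2 + 1),
    bb k₁ p.1 s t₁ * bb k₂ p.2 s t₂ * f (k₂ + p.1 - k₁, k₁ + p.2 - k₂)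

noncomputable def Lam (s t : ℝ) (g : ℕ → ℕ → ℝ) (n : ℕ) : ℝ :=
  ∑ p ∈ Finset.HasAntidiagonal.antidiagonal n, (n.choose p.1 : ℝ) *
    (betaFn ((p.1 : ℝ) + s) ((p.2 : ℝ) + t) / betaFn s t * g p.1 p.2)

theorem beta_left (s t : ℝ) (hs : 0 < s) (ht : 0 < t) (a b : ℕ) :
    (s + t + (a + b)) * betaFn ((a + 1 : ℕ) + s) (b + t) = (s + a) * betaFn (a + s) (b + t) := by
  unfold betaFn
  have h1 : (0:ℝ) < a + s := by positivity
  have h3 : (0:ℝ) < a + s + (b + t) := by positivity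
  have e1 : ((a + 1 : ℕ) : ℝ) + s = (a + s) + 1 := by push_cast; ring
  have e2 : (a:ℝ) + s + 1 + (b + t) = (a + s + (b + t)) + 1 := by ring
  rw [e1, e2, Real.Gamma_add_one h1.ne', Real.Gamma_add_one h3.ne']
  have := (Real.Gamma_pos_of_pos h3).ne'
  field_simp
  ring

theorem beta_symm (x y : ℝ) : betaFn x y = betaFn y x := by
  unfold betaFn
  rw [mul_comm, add_comm]

theorem beta_right (s t : ℝ) (hs : 0 < s) (ht : 0 < t) (a b : ℕ) :
    (s + t + (a + b)) * betaFn (a + s) ((b + 1 : ℕ) + t) = (t + b) * betaFn (a + s) (b + t) := by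
  have := beta_left t s ht hs b a
  rw [beta_symm, beta_symm (a + s) (b + t), ← this]
  ring

theorem Lam_add (s t : ℝ) (g h : ℕ → ℕ → ℝ) (n : ℕ) :
    Lam s t (fun a b => g a b + h a b) n = Lam s t g n + Lam s t h n := by
  simp only [Lam, mul_add, Finset.sum_add_distrib]

theorem Kop_Lam (α : SUIdx) (κ s t : ℝ) (g : ℕ → ℕ → ℕ → ℝ) (m n : ℕ) :
    Kop α κ (fun x => Lam s t (g x) m) n
      = Lam s t (fun a b => Kop α κ (fun x => g x a b) n) m := by
  cases α <;> simp only [Kop, Lam, Finset.mul_sum] <;>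
    refine Finset.sum_congr rfl fun p _ => ?_ <;> ring

theorem Kop_split (α : SUIdx) (κ κ' : ℝ) (h : ℕ → ℝ) (a b : ℕ) :
    Kop α (κ + κ') h (a + b)
      = Kop α κ (fun u => h (u + b)) a + Kop α κ' (fun u => h (a + u)) b := by
  cases α
  · simp only [Kop]
    rw [show a + 1 + b = a + b + 1 by ring, show a + (b + 1) = a + b + 1 by ring]
    push_cast; ring
  · simp only [Kop]
    rcases a with _ | a <;> rcases b with _ | b
    · simp
    · simp
    · simp
    · rw [show a + 1 + (b + 1) - 1 = a + b + 1 by omega, show a + 1 - 1 + (b + 1) = a + b + 1 by omega,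
        show a + 1 + (b + 1 - 1) = a + b + 1 by omega]
      push_cast; ring
  · simp only [Kop]
    push_cast; ring

theorem Lam_inter (α : SUIdx) (s t : ℝ) (hs : 0 < s) (ht : 0 < t) (g : ℕ → ℕ → ℝ) (n : ℕ) :
    Lam s t (fun a b => Kop α s (fun x => g x b) a + Kop α t (fun y => g a y) b) n
      = Kop α (s + t) (Lam s t g) n := by
  cases α
  · simp only [Kop, Lam]
    rw [Finset.sum_antidiagonal_choose_succ_mul
      (fun i j => betaFn ((i : ℝ) + s) ((j : ℝ) + t) / betaFn s t * g i j),
      ← Finset.sum_add_distrib, Finset.mul_sum]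
    refine Finset.sum_congr rfl fun p hp => ?_
    obtain ⟨a, b⟩ := p
    have hn : a + b = n := by simpa using hp
    subst hn
    have h1 := beta_left s t hs ht a b
    have h2 := beta_right s t hs ht a b
    have h3 : (a + b).choose b = (a + b).choose a := by
      rw [Nat.choose_symm_add]
    simp only [h3]
    push_cast at h1 h2 ⊢
    linear_combination (-((a + b).choose a : ℝ) / betaFn s t * g (a+1) b) * h1
      - (((a + b).choose a : ℝ) / betaFn s t * g a (b+1)) * h2
  · rcases n with _ | n
    · simp [Kop, Lam]
    rw [Lam_add]
    simp only [Kop, Lam]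
    rw [Finset.Nat.sum_antidiagonal_succ, Finset.Nat.sum_antidiagonal_succ', Finset.mul_sum]
    simp only [Nat.cast_zero, zero_mul, mul_zero, zero_add, add_zero, Nat.add_sub_cancel]
    rw [← Finset.sum_add_distrib]
    refine Finset.sum_congr rfl fun p hp => ?_
    obtain ⟨a, b⟩ := p
    have hn : a + b = n := by simpa using hp
    subst hn
    have h1 := beta_left s t hs ht a b
    have h2 := beta_right s t hs ht a b
    have c1 : ((a + b + 1).choose (a+1) : ℝ) * (a + 1) = (a + b + 1) * (a + b).choose a := by
      exact_mod_cast (Nat.add_one_mul_choose_eq (a+b) a).symm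
    have c2 : ((a + b + 1).choose a : ℝ) * (b + 1) = (a + b + 1) * (a + b).choose a := by
      have := Nat.add_one_mul_choose_eq (a+b) b
      rw [show (a+b).choose b = (a + b).choose a by rw [Nat.choose_symm_add],
        show (a+b+1).choose (b+1) = (a+b+1).choose a by
          rw [add_assoc, Nat.choose_symm_add]] at this
      exact_mod_cast this.symm
    have hpos : (s + t + (a + b) : ℝ) ≠ 0 := by positivity
    have key : betaFn ((a + 1 : ℕ) + s) (b + t) + betaFn (a + s) ((b + 1 : ℕ) + t)
        = betaFn (a + s) (b + t) := by
      apply mul_left_cancel₀ hpos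
      linear_combination h1 + h2
    push_cast at key ⊢
    linear_combination (betaFn (a + 1 + s) (b + t) / betaFn s t * g a b) * c1
      + (betaFn (a + s) (b + 1 + t) / betaFn s t * g a b) * c2
      + ((a + b + 1) * (a + b).choose a / betaFn s t * g a b) * key
  · simp only [Kop, Lam, Finset.mul_sum]
    refine Finset.sum_congr rfl fun p hp => ?_
    have hn : p.1 + p.2 = n := by simpa using hp
    subst hn
    push_cast; ring

theorem sum_bb (s t : ℝ) (g : ℕ → ℕ → ℝ) (n : ℕ) :
    ∑ k ∈ Finset.range (n + 1), bb k n s t * g k (n - k) = Lam s t g n := by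
  unfold Lam
  rw [Finset.Nat.sum_antidiagonal_eq_sum_range_succ_mk]
  refine Finset.sum_congr rfl fun k _ => ?_
  simp only [bb]; ring

theorem Pi_eq_s12 (s t₁ t₂ : ℝ) (f : ℕ × ℕ → ℝ) (n₁ n₂ : ℕ) :
    PiIEM s t₁ t₂ f (n₁, n₂)
      = Lam s t₁ (fun a b => Lam s t₂ (fun c d => f (c + b, a + d)) n₂) n₁ := by
  rw [← sum_bb]
  simp only [PiIEM]
  refine Finset.sum_congr rfl fun k hk => ?_
  rw [← sum_bb, Finset.mul_sum]
  refine Finset.sum_congr rfl fun l hl => ?_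
  simp only [Finset.mem_range] at hk hl
  rw [Nat.add_sub_assoc (by omega), Nat.add_sub_assoc (by omega)]
  ring

/-- For `s, t₁, t₂ > 0`, the transition operator of IEM(s,t₁;s,t₂) commutes with
`K^{α,s+t₁}_1 + K^{α,s+t₂}_2` for each `α ∈ {+,-,0}`. -/
theorem IEMst_commutes_with_K (s t₁ t₂ : ℝ) (hs : 0 < s) (ht₁ : 0 < t₁) (ht₂ : 0 < t₂)
    (α : SUIdx) (f : ℕ × ℕ → ℝ) (n₁ n₂ : ℕ) :
    PiIEM s t₁ t₂ (fun p => K1 α (s + t₁) f p + K2 α (s + t₂) f p) (n₁, n₂)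
      = K1 α (s + t₁) (PiIEM s t₁ t₂ f) (n₁, n₂)
        + K2 α (s + t₂) (PiIEM s t₁ t₂ f) (n₁, n₂) := by
  simp only [K1, K2, Pi_eq_s12]
  rw [Kop_Lam α (s + t₂) s t₁ (fun x a b => Lam s t₂ (fun c d => f (c + b, a + d)) x) n₁ n₂,
    ← Lam_inter α s t₁ hs ht₁, ← Lam_add]
  congr 1
  funext a b
  rw [← Lam_inter α s t₂ hs ht₂,
    Kop_Lam α s s t₂ (fun x c d => f (c + b, x + d)),
    Kop_Lam α t₁ s t₂ (fun x c d => f (c + x, a + d)), ← Lam_add, ← Lam_add]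
  congr 1
  funext c d
  rw [Kop_split α s t₁ (fun x => f (x, a + d)), Kop_split α s t₂ (fun x => f (c + b, x))]
  ring
end

section
/- Let s, t₁, t₂ > 0. The transition operator Π of the generalized immediate exchange model IEM(s,t₁;s,t₂) is self-dual with self-duality function D(k₁,k₂;n₁,n₂) = d_{s+t₁}(k₁,n₁)·d_{s+t₂}(k₂,n₂), where for r > 0, d_r(k,n) = (n!/(n−k)!)·Γ(r)/Γ(r+k) if k ≤ n and d_r(k,n) = 0 if k > n. -/
/-- The single-site self-duality function `d_r(k,n) = (n!/(n-k)!)·Γ(r)/Γ(r+k)` for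
`k ≤ n`, and `0` for `k > n`. -/
noncomputable def dR (r : ℝ) (k n : ℕ) : ℝ :=
  if k ≤ n then ((n.factorial : ℝ) / (n - k).factorial) * (Real.Gamma r / Real.Gamma (r + k))
  else 0

/-- Rising factorial. -/
noncomputable def Rf (x : ℝ) (k : ℕ) : ℝ := ∏ i ∈ Finset.range k, (x + i)

lemma Rf_zero (x : ℝ) : Rf x 0 = 1 := by simp [Rf]

lemma Rf_succ (x : ℝ) (k : ℕ) : Rf x (k + 1) = x * Rf (x + 1) k := by
  unfold Rf
  rw [Finset.prod_range_succ']
  simp only [Nat.cast_zero, add_zero]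
  rw [mul_comm]
  congr 1
  apply Finset.prod_congr rfl
  intro i _
  push_cast
  ring

lemma Rf_pos {x : ℝ} (hx : 0 < x) (k : ℕ) : 0 < Rf x k :=
  Finset.prod_pos fun i _ => by positivity

lemma Gamma_Rf {x : ℝ} (hx : 0 < x) (k : ℕ) :
    Real.Gamma (x + k) = Real.Gamma x * Rf x k := by
  induction k with
  | zero => simp [Rf_zero]
  | succ k ih =>
    have h : x + ((k + 1 : ℕ) : ℝ) = (x + k) + 1 := by push_cast; ring
    rw [h, Real.Gamma_add_one (by positivity), ih]
    unfold Rf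
    rw [Finset.prod_range_succ]
    ring

lemma bb_eq {s t : ℝ} (hs : 0 < s) (ht : 0 < t) {n : ℕ} {x : ℕ × ℕ}
    (hx : x ∈ Finset.HasAntidiagonal.antidiagonal n) :
    bb x.1 n s t = (n.choose x.1 : ℝ) * Rf s x.1 * Rf t x.2 / Rf (s + t) n := by
  obtain ⟨i, j⟩ := x
  rw [Finset.HasAntidiagonal.mem_antidiagonal] at hx
  simp only at hx ⊢
  subst hx
  have h1 := (Real.Gamma_pos_of_pos hs).ne'
  have h2 := (Real.Gamma_pos_of_pos ht).ne'
  have h3 := (Real.Gamma_pos_of_pos (add_pos hs ht)).ne'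
  have h4 := (Rf_pos (add_pos hs ht) (i + j)).ne'
  unfold bb betaFn
  rw [Nat.add_sub_cancel_left]
  have e : (i : ℝ) + s + (j + t) = (s + t) + ((i + j : ℕ) : ℝ) := by push_cast; ring
  rw [e, Gamma_Rf (add_pos hs ht), add_comm (i : ℝ) s, add_comm (j : ℝ) t, Gamma_Rf hs,
    Gamma_Rf ht]
  field_simp

lemma dR_eq {r : ℝ} (hr : 0 < r) (k n : ℕ) :
    dR r k n = (n.descFactorial k : ℝ) / Rf r k := by
  have h1 := (Real.Gamma_pos_of_pos hr).ne'
  have h4 := (Rf_pos hr k).ne'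
  unfold dR
  split_ifs with h
  · have := Nat.factorial_mul_descFactorial h
    rw [← this, Gamma_Rf hr]
    have : ((n - k).factorial : ℝ) ≠ 0 := by positivity
    push_cast
    field_simp
  · rw [Nat.descFactorial_of_lt (by omega)]
    simp

lemma vand (n : ℕ) : ∀ s t : ℝ, ∑ x ∈ Finset.HasAntidiagonal.antidiagonal n,
    (n.choose x.1 : ℝ) * (Rf s x.1 * Rf t x.2) = Rf (s + t) n := by
  induction n with
  | zero => intro s t; simp [Rf_zero]
  | succ n ih =>
    intro s t
    have := Finset.sum_antidiagonal_choose_succ_mul (fun i j => Rf s i * Rf t j) n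
    rw [this]
    simp only [Rf_succ]
    have e1 := ih s (t + 1)
    have e2 := ih (s + 1) t
    have e3 : s + 1 + t = s + t + 1 := by ring
    have e4 : s + (t + 1) = s + t + 1 := by ring
    rw [e4] at e1
    rw [e3] at e2
    have e5 : (s + t) * Rf (s + t + 1) n = s * Rf (s + t + 1) n + t * Rf (s + t + 1) n := by ring
    rw [e5]
    nth_rewrite 1 [← e2]
    rw [← e1, Finset.mul_sum, Finset.mul_sum, add_comm]
    congr 1
    · apply Finset.sum_congr rfl
      intro x hx
      rw [show n.choose x.2 = n.choose x.1 from (Nat.choose_symm_of_eq_add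
        (by rw [Finset.HasAntidiagonal.mem_antidiagonal] at hx; omega))]
      ring
    · apply Finset.sum_congr rfl
      intro x hx
      ring

noncomputable def Mom (n : ℕ) (s t : ℝ) (b c : ℕ) : ℝ := ∑ x ∈ Finset.HasAntidiagonal.antidiagonal n,
    (n.choose x.1 : ℝ) * (Rf s x.1 * Rf t x.2) * (x.1.descFactorial b * x.2.descFactorial c)

lemma Mom_swap (n : ℕ) (s t : ℝ) (b c : ℕ) : Mom n s t b c = Mom n t s c b := by
  unfold Mom
  rw [← Finset.Nat.sum_antidiagonal_swap]
  apply Finset.sum_congr rfl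
  intro x hx
  simp only [Prod.fst_swap, Prod.snd_swap]
  rw [show n.choose x.2 = n.choose x.1 from (Nat.choose_symm_of_eq_add
        (by rw [Finset.HasAntidiagonal.mem_antidiagonal] at hx; omega))]
  ring

lemma Mom_succ (n : ℕ) (s t : ℝ) (b c : ℕ) :
    Mom (n + 1) s t (b + 1) c = (n + 1) * s * Mom n (s + 1) t b c := by
  unfold Mom
  rw [Finset.Nat.sum_antidiagonal_succ, Finset.mul_sum]
  simp only [Nat.zero_descFactorial_succ, Nat.cast_zero, zero_mul, mul_zero, zero_add]
  apply Finset.sum_congr rfl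
  intro x hx
  have h : ((n + 1 : ℝ)) * n.choose x.1 = (n + 1).choose (x.1 + 1) * (x.1 + 1) := by
    exact_mod_cast Nat.add_one_mul_choose_eq n x.1
  rw [Nat.succ_descFactorial_succ, Rf_succ]
  push_cast
  linear_combination (- s * Rf (s+1) x.1 * Rf t x.2 * x.1.descFactorial b * x.2.descFactorial c) * h

lemma Mom_zero_succ (s t : ℝ) (b c : ℕ) : Mom 0 s t (b + 1) c = 0 := by
  simp [Mom]

lemma Mom_step (c : ℕ) (b : ℕ) (h0 : ∀ (n : ℕ) (s t : ℝ),
      Mom n s t 0 c * Rf (s + t) c = n.descFactorial c * Rf t c * Rf (s + t) n) :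
    ∀ (n : ℕ) (s t : ℝ), Mom n s t b c * Rf (s + t) (b + c)
      = n.descFactorial (b + c) * Rf s b * Rf t c * Rf (s + t) n := by
  induction b with
  | zero => intro n s t; simpa [Rf_zero] using h0 n s t
  | succ b ih =>
    intro n s t
    have e : b + 1 + c = (b + c) + 1 := by ring
    rw [e]
    cases n with
    | zero => simp [Mom_zero_succ]
    | succ n =>
      rw [Mom_succ, Nat.succ_descFactorial_succ, Rf_succ, Rf_succ, Rf_succ]
      have := ih n (s + 1) t
      rw [show s + 1 + t = s + t + 1 by ring] at this
      push_cast
      linear_combination ((n + 1) * s * (s + t)) * this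

lemma Mom_eq (n : ℕ) (s t : ℝ) (b c : ℕ) : Mom n s t b c * Rf (s + t) (b + c)
      = n.descFactorial (b + c) * Rf s b * Rf t c * Rf (s + t) n := by
  apply Mom_step
  intro n s t
  rw [Mom_swap, add_comm s t]
  have := Mom_step 0 c (by
    intro n s t
    simp [Rf_zero, Mom, vand]) n t s
  simpa [Rf_zero] using this

lemma desc_add (m l k : ℕ) : ((m + l).descFactorial k : ℝ) = ∑ x ∈ Finset.HasAntidiagonal.antidiagonal k,
    (k.choose x.1 : ℝ) * (m.descFactorial x.1 * l.descFactorial x.2) := by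
  rw [Nat.descFactorial_eq_factorial_mul_choose, Nat.add_choose_eq]
  push_cast
  rw [Finset.mul_sum]
  apply Finset.sum_congr rfl
  rintro ⟨i, j⟩ hx
  rw [Finset.HasAntidiagonal.mem_antidiagonal] at hx
  simp only at hx ⊢
  subst hx
  rw [Nat.descFactorial_eq_factorial_mul_choose, Nat.descFactorial_eq_factorial_mul_choose]
  have : (((i + j).choose i * i.factorial * j.factorial : ℕ) : ℝ) = (i + j).factorial := by
    have h := Nat.add_choose_mul_factorial_mul_factorial j i
    rw [add_comm j i] at h
    rw [← h]
    push_cast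
    ring
  push_cast at this ⊢
  rw [← this]
  ring

lemma Pi_eq_s13 {s t₁ t₂ : ℝ} (hs : 0 < s) (ht₁ : 0 < t₁) (ht₂ : 0 < t₂) (f : ℕ × ℕ → ℝ)
    (p : ℕ × ℕ) : PiIEM s t₁ t₂ f p =
    ∑ x ∈ Finset.HasAntidiagonal.antidiagonal p.1, ∑ y ∈ Finset.HasAntidiagonal.antidiagonal p.2,
      ((p.1.choose x.1 : ℝ) * Rf s x.1 * Rf t₁ x.2 / Rf (s + t₁) p.1) *
      ((p.2.choose y.1 : ℝ) * Rf s y.1 * Rf t₂ y.2 / Rf (s + t₂) p.2) *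
      f (y.1 + x.2, x.1 + y.2) := by
  have : PiIEM s t₁ t₂ f p = ∑ x ∈ Finset.HasAntidiagonal.antidiagonal p.1, ∑ y ∈ Finset.HasAntidiagonal.antidiagonal p.2,
      bb x.1 p.1 s t₁ * bb y.1 p.2 s t₂ * f (y.1 + x.2, x.1 + y.2) := by
    unfold PiIEM
    rw [Finset.Nat.sum_antidiagonal_eq_sum_range_succ (fun i j =>
      ∑ y ∈ Finset.HasAntidiagonal.antidiagonal p.2, bb i p.1 s t₁ * bb y.1 p.2 s t₂ * f (y.1 + j, i + y.2))]
    apply Finset.sum_congr rfl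
    intro i hi
    rw [Finset.Nat.sum_antidiagonal_eq_sum_range_succ (fun k l =>
      bb i p.1 s t₁ * bb k p.2 s t₂ * f (k + (p.1 - i), i + l))]
    apply Finset.sum_congr rfl
    intro k hk
    rw [Finset.mem_range] at hi hk
    rw [Nat.add_sub_assoc (by omega), Nat.add_sub_assoc (by omega)]
  rw [this]
  apply Finset.sum_congr rfl
  intro x hx
  apply Finset.sum_congr rfl
  intro y hy
  rw [bb_eq hs ht₁ hx, bb_eq hs ht₂ hy]

/-- For `s, t₁, t₂ > 0`, the generalized immediate exchange model IEM(s,t₁;s,t₂) is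
self-dual with self-duality function `D(k₁,k₂;n₁,n₂) = d_{s+t₁}(k₁,n₁)·d_{s+t₂}(k₂,n₂)`. -/
theorem IEMst_selfDual (s t₁ t₂ : ℝ) (hs : 0 < s) (ht₁ : 0 < t₁) (ht₂ : 0 < t₂) :
    IsSelfDual (PiIEM s t₁ t₂)
      (fun k n => dR (s + t₁) k.1 n.1 * dR (s + t₂) k.2 n.2) := by
  have hr₁ : 0 < s + t₁ := by positivity
  have hr₂ : 0 < s + t₂ := by positivity
  rintro ⟨k₁, k₂⟩ ⟨n₁, n₂⟩
  rw [Pi_eq_s13 hs ht₁ ht₂, Pi_eq_s13 hs ht₁ ht₂]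
  simp only [dR_eq hr₁, dR_eq hr₂]
  have key : ∀ u v : ℕ × ℕ,
      (((v.1 + u.2).descFactorial k₁ : ℝ) / Rf (s + t₁) k₁) *
        (((u.1 + v.2).descFactorial k₂ : ℝ) / Rf (s + t₂) k₂) =
      ∑ x ∈ Finset.HasAntidiagonal.antidiagonal k₁, ∑ y ∈ Finset.HasAntidiagonal.antidiagonal k₂,
        ((k₁.choose x.1 : ℝ) * (v.1.descFactorial x.1 * u.2.descFactorial x.2)) *
        ((k₂.choose y.1 : ℝ) * (u.1.descFactorial y.1 * v.2.descFactorial y.2)) /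
        (Rf (s + t₁) k₁ * Rf (s + t₂) k₂) := by
    intro u v
    rw [desc_add, desc_add, div_mul_div_comm, Finset.sum_mul_sum, Finset.sum_div]
    simp only [Finset.sum_div]
  simp only [key, Finset.mul_sum]
  have p1 := (Rf_pos hr₁ k₁).ne'
  have p2 := (Rf_pos hr₂ k₂).ne'
  have p3 := (Rf_pos hr₁ n₁).ne'
  have p4 := (Rf_pos hr₂ n₂).ne'
  have swap : ∀ F : ℕ × ℕ → ℕ × ℕ → ℕ × ℕ → ℕ × ℕ → ℝ,
      ∑ u ∈ Finset.HasAntidiagonal.antidiagonal n₁, ∑ v ∈ Finset.HasAntidiagonal.antidiagonal n₂,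
        ∑ x ∈ Finset.HasAntidiagonal.antidiagonal k₁, ∑ y ∈ Finset.HasAntidiagonal.antidiagonal k₂, F u v x y =
      ∑ x ∈ Finset.HasAntidiagonal.antidiagonal k₁, ∑ y ∈ Finset.HasAntidiagonal.antidiagonal k₂,
        ∑ u ∈ Finset.HasAntidiagonal.antidiagonal n₁, ∑ v ∈ Finset.HasAntidiagonal.antidiagonal n₂, F u v x y := by
    intro F
    rw [Finset.sum_congr rfl fun u _ => Finset.sum_comm, Finset.sum_comm]
    apply Finset.sum_congr rfl
    intro x _
    rw [Finset.sum_congr rfl fun u _ => Finset.sum_comm, Finset.sum_comm]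
  rw [swap]
  apply Finset.sum_congr rfl
  intro x hx
  apply Finset.sum_congr rfl
  intro y hy
  have m1 := Mom_eq n₁ s t₁ y.1 x.2
  have m2 := Mom_eq n₂ s t₂ x.1 y.2
  have q1 := (Rf_pos hr₁ (y.1 + x.2)).ne'
  have q2 := (Rf_pos hr₂ (x.1 + y.2)).ne'
  rw [← eq_div_iff q1] at m1
  rw [← eq_div_iff q2] at m2
  trans ((k₁.choose x.1 : ℝ) * k₂.choose y.1 / (Rf (s + t₁) k₁ * Rf (s + t₂) k₂)
    / (Rf (s + t₁) n₁ * Rf (s + t₂) n₂)) * (Mom n₁ s t₁ y.1 x.2 * Mom n₂ s t₂ x.1 y.2)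
  · rw [m1, m2]
    field_simp
  · unfold Mom
    rw [Finset.sum_mul_sum, Finset.mul_sum]
    apply Finset.sum_congr rfl
    intro u _
    rw [Finset.mul_sum]
    apply Finset.sum_congr rfl
    intro v _
    ring
end

section
/- Let s, t₁, t₂ > 0 and 0 < λ < 1. The product of the discrete Γ(s+t₁,λ) and Γ(s+t₂,λ) distributions is reversible for the transition operator Π of the generalized immediate exchange model IEM(s,t₁;s,t₂): for all finitely supported f, g : ℕ² → ℝ, ∑_{(n₁,n₂) ∈ ℕ²} (Πf)(n₁,n₂)·g(n₁,n₂)·ν^{s+t₁}_λ(n₁)·ν^{s+t₂}_λ(n₂) = ∑_{(n₁,n₂) ∈ ℕ²} f(n₁,n₂)·(Πg)(n₁,n₂)·ν^{s+t₁}_λ(n₁)·ν^{s+t₂}_λ(n₂). -/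
/-- The discrete Γ(β,λ) weight `ν^β_λ(n) = (1-λ)^β · (λⁿ/n!) · Γ(n+β)/Γ(β)`. -/
noncomputable def nuGamma (β lam : ℝ) (n : ℕ) : ℝ :=
  (1 - lam) ^ β * (lam ^ n / n.factorial) * (Real.Gamma ((n : ℝ) + β) / Real.Gamma β)

lemma bb_nu (s t lam : ℝ) (hs : 0 < s) (ht : 0 < t) (h1 : lam < 1) (n k : ℕ) (hk : k ≤ n) :
    bb k n s t * nuGamma (s + t) lam n = nuGamma s lam k * nuGamma t lam (n - k) := by
  obtain ⟨m, rfl⟩ := Nat.exists_eq_add_of_le hk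
  have hm : k + m - k = m := by omega
  have hc : ((k + m).choose k : ℝ) = (k + m).factorial / (k.factorial * m.factorial) := by
    rw [Nat.cast_choose ℝ hk, hm]
  have e1 : ((k : ℝ) + s) + ((m : ℝ) + t) = ((k + m : ℕ) : ℝ) + (s + t) := by push_cast; ring
  unfold bb nuGamma betaFn
  rw [hm, hc, e1, Real.rpow_add (by linarith : 0 < 1 - lam), pow_add]
  have g1 := (Real.Gamma_pos_of_pos hs).ne'
  have g2 := (Real.Gamma_pos_of_pos ht).ne'
  have g3 := (Real.Gamma_pos_of_pos (add_pos hs ht)).ne'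
  have g4 : Real.Gamma (((k + m : ℕ) : ℝ) + (s + t)) ≠ 0 :=
    (Real.Gamma_pos_of_pos (by positivity)).ne'
  have f1 : ((k + m).factorial : ℝ) ≠ 0 := by positivity
  have f2 : (k.factorial : ℝ) ≠ 0 := by positivity
  have f3 : (m.factorial : ℝ) ≠ 0 := by positivity
  generalize Real.Gamma (((k + m : ℕ) : ℝ) + (s + t)) = G at *
  generalize ((k + m).factorial : ℝ) = F at *
  field_simp

def sumMap (q : (ℕ × ℕ) × (ℕ × ℕ)) : ℕ × ℕ := (q.1.1 + q.1.2, q.2.1 + q.2.2)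

lemma sumMap_fiber (n : ℕ × ℕ) : sumMap ⁻¹' {n} =
    ((Finset.HasAntidiagonal.antidiagonal n.1 ×ˢ Finset.HasAntidiagonal.antidiagonal n.2 : Finset _) :
      Set ((ℕ × ℕ) × (ℕ × ℕ))) := by
  ext q
  simp [sumMap, Prod.ext_iff]

lemma tsum_split (H : (ℕ × ℕ) × (ℕ × ℕ) → ℝ) (hH : (Function.support H).Finite) :
    ∑' n : ℕ × ℕ, ∑ x ∈ Finset.HasAntidiagonal.antidiagonal n.1, ∑ y ∈ Finset.HasAntidiagonal.antidiagonal n.2, H (x, y)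
      = ∑' q, H q := by
  have h := (summable_of_hasFiniteSupport hH).hasSum.tsum_fiberwise sumMap
  rw [← h.tsum_eq]
  refine tsum_congr fun n => ?_
  rw [sumMap_fiber, Finset.tsum_subtype', Finset.sum_product]

def swapE : (ℕ × ℕ) × (ℕ × ℕ) ≃ (ℕ × ℕ) × (ℕ × ℕ) where
  toFun q := ((q.2.1, q.1.2), (q.1.1, q.2.2))
  invFun q := ((q.2.1, q.1.2), (q.1.1, q.2.2))
  left_inv _ := rfl
  right_inv _ := rfl

noncomputable def HH (s t₁ t₂ lam : ℝ) (f g : ℕ × ℕ → ℝ) (q : (ℕ × ℕ) × (ℕ × ℕ)) : ℝ :=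
  nuGamma s lam q.1.1 * nuGamma t₁ lam q.1.2 * (nuGamma s lam q.2.1 * nuGamma t₂ lam q.2.2)
    * f (q.2.1 + q.1.2, q.1.1 + q.2.2) * g (sumMap q)

lemma HH_fin (s t₁ t₂ lam : ℝ) (f g : ℕ × ℕ → ℝ) (hg : (Function.support g).Finite) :
    (Function.support (HH s t₁ t₂ lam f g)).Finite := by
  refine (Set.Finite.preimage' (f := sumMap) hg fun b _ => ?_).subset fun q hq => ?_
  · rw [sumMap_fiber]; exact Finset.finite_toSet _
  · exact right_ne_zero_of_mul hq

lemma key (s t₁ t₂ lam : ℝ) (hs : 0 < s) (ht₁ : 0 < t₁) (ht₂ : 0 < t₂) (h1 : lam < 1)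
    (f g : ℕ × ℕ → ℝ) (hg : (Function.support g).Finite) :
    ∑' n : ℕ × ℕ, PiIEM s t₁ t₂ f n * g n * (nuGamma (s + t₁) lam n.1 * nuGamma (s + t₂) lam n.2)
      = ∑' q, HH s t₁ t₂ lam f g q := by
  rw [← tsum_split _ (HH_fin s t₁ t₂ lam f g hg)]
  refine tsum_congr fun n => ?_
  rw [Finset.Nat.sum_antidiagonal_eq_sum_range_succ_mk]
  unfold PiIEM
  rw [Finset.sum_mul, Finset.sum_mul]
  refine Finset.sum_congr rfl fun a ha => ?_
  rw [Finset.Nat.sum_antidiagonal_eq_sum_range_succ_mk, Finset.sum_mul, Finset.sum_mul]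
  refine Finset.sum_congr rfl fun c hc => ?_
  have ha' : a ≤ n.1 := by simpa [Nat.lt_succ_iff] using ha
  have hc' : c ≤ n.2 := by simpa [Nat.lt_succ_iff] using hc
  simp only [HH, sumMap]
  rw [← bb_nu s t₁ lam hs ht₁ h1 _ _ ha', ← bb_nu s t₂ lam hs ht₂ h1 _ _ hc',
    Nat.add_sub_cancel' ha', Nat.add_sub_cancel' hc', Nat.add_sub_assoc ha', Nat.add_sub_assoc hc']
  ring

/-- For `s, t₁, t₂ > 0` and `0 < λ < 1`, the product of the discrete Γ(s+t₁,λ) and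
Γ(s+t₂,λ) distributions is reversible for the transition operator of IEM(s,t₁;s,t₂). -/
theorem IEMst_reversible (s t₁ t₂ lam : ℝ) (hs : 0 < s) (ht₁ : 0 < t₁) (ht₂ : 0 < t₂)
    (h0 : 0 < lam) (h1 : lam < 1)
    (f g : ℕ × ℕ → ℝ) (hf : (Function.support f).Finite) (hg : (Function.support g).Finite) :
    ∑' n : ℕ × ℕ, PiIEM s t₁ t₂ f n * g n * (nuGamma (s + t₁) lam n.1 * nuGamma (s + t₂) lam n.2)
      = ∑' n : ℕ × ℕ,
          f n * PiIEM s t₁ t₂ g n * (nuGamma (s + t₁) lam n.1 * nuGamma (s + t₂) lam n.2) := by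
  rw [key s t₁ t₂ lam hs ht₁ ht₂ h1 f g hg]
  have e : ∀ n : ℕ × ℕ,
      f n * PiIEM s t₁ t₂ g n * (nuGamma (s + t₁) lam n.1 * nuGamma (s + t₂) lam n.2)
      = PiIEM s t₁ t₂ g n * f n * (nuGamma (s + t₁) lam n.1 * nuGamma (s + t₂) lam n.2) :=
    fun n => by ring
  rw [tsum_congr e, key s t₁ t₂ lam hs ht₁ ht₂ h1 g f hf, ← swapE.tsum_eq]
  refine tsum_congr fun q => ?_
  simp only [HH, sumMap, swapE, Equiv.coe_fn_mk]
  ring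
end

section
/- Let γ, δ₁, δ₂ be positive integers. The transition operator Π of the restricted immediate exchange model RIEM(γ,δ₁;γ,δ₂) is self-dual with self-duality function D(k₁,k₂;n₁,n₂) = d_{γ+δ₁}(k₁,n₁)·d_{γ+δ₂}(k₂,n₂), where for an integer r ≥ 1, d_r(k,n) = C(n,k)/C(r,k) if k ≤ n ≤ r and d_r(k,n) = 0 if k > n or n > r; that is, for all (k₁,k₂) and (n₁,n₂) with k₁, n₁ ≤ γ+δ₁ and k₂, n₂ ≤ γ+δ₂, the value at (k₁,k₂) of Π applied to (m₁,m₂) ↦ D(m₁,m₂;n₁,n₂) equals the value at (n₁,n₂) of Π applied to (m₁,m₂) ↦ D(k₁,k₂;m₁,m₂). -/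
/-- The hypergeometric weight `hyp(k;n,γ,δ) = C(γ,k)·C(δ,n-k)/C(γ+δ,n)`
(binomial coefficients vanish when the lower index exceeds the upper one). -/
noncomputable def hypW (k n γ δ : ℕ) : ℝ :=
  (γ.choose k : ℝ) * (δ.choose (n - k) : ℝ) / ((γ + δ).choose n : ℝ)

/-- The transition operator of the restricted immediate exchange model RIEM(γ,δ₁;γ,δ₂):
`(Πf)(n₁,n₂) = ∑_{k₁=0}^{n₁} ∑_{k₂=0}^{n₂} hyp(k₁;n₁,γ,δ₁)·hyp(k₂;n₂,γ,δ₂)·f(k₂+n₁-k₁, k₁+n₂-k₂)`. -/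
noncomputable def PiRIEM (γ δ₁ δ₂ : ℕ) (f : ℕ × ℕ → ℝ) : ℕ × ℕ → ℝ := fun p =>
  ∑ k₁ ∈ Finset.range (p.1 + 1), ∑ k₂ ∈ Finset.range (p.2 + 1),
    hypW k₁ p.1 γ δ₁ * hypW k₂ p.2 γ δ₂ * f (k₂ + p.1 - k₁, k₁ + p.2 - k₂)

/-- The single-site self-duality function `d_r(k,n) = C(n,k)/C(r,k)` for `k ≤ n ≤ r`,
and `0` if `k > n` or `n > r`. -/
noncomputable def dChoose (r k n : ℕ) : ℝ :=
  if k ≤ n ∧ n ≤ r then (n.choose k : ℝ) / (r.choose k : ℝ) else 0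

lemma vand1 (b m k : ℕ) : ((b + m).choose k : ℝ)
    = ∑ s ∈ Finset.range (k + 1), (b.choose s : ℝ) * (m.choose (k - s) : ℝ) := by
  rw [Nat.add_choose_eq, Finset.Nat.sum_antidiagonal_eq_sum_range_succ_mk]
  push_cast
  rfl

lemma choose_mul_sub (g u a : ℕ) : g.choose (u + a) * (u + a).choose u
    = g.choose u * (g - u).choose a := by
  by_cases h : u + a ≤ g
  · rw [Nat.choose_mul (Nat.le_add_right u a)]
    simp
  · rw [Nat.choose_eq_zero_of_lt (by omega : g < u + a)]
    by_cases hu : u ≤ g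
    · rw [Nat.choose_eq_zero_of_lt (by omega : g - u < a)]; simp
    · rw [Nat.choose_eq_zero_of_lt (by omega : g < u)]; simp

lemma vand2 (γ δ u t n : ℕ) (hn : n ≤ γ + δ) :
    (γ.choose u : ℝ) * (δ.choose t : ℝ) * dChoose (γ + δ) (u + t) n * ((γ + δ).choose n : ℝ)
    = ∑ a ∈ Finset.range (n + 1), ((γ.choose a : ℝ) * (a.choose u : ℝ)) *
        ((δ.choose (n - a) : ℝ) * ((n - a).choose t : ℝ)) := by
  by_cases hut : u + t ≤ n
  · obtain ⟨w, rfl⟩ := Nat.exists_eq_add_of_le hut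
    have h1 : ∑ a ∈ Finset.range (w + 1), ((γ.choose (u + a) : ℝ) * ((u + a).choose u : ℝ)) *
        ((δ.choose (t + (w - a)) : ℝ) * ((t + (w - a)).choose t : ℝ))
        = ∑ a ∈ Finset.range (u + t + w + 1), ((γ.choose a : ℝ) * (a.choose u : ℝ)) *
        ((δ.choose (u + t + w - a) : ℝ) * ((u + t + w - a).choose t : ℝ)) := by
      apply Finset.sum_of_injOn (fun a => u + a)
      · intro a _ b _ h
        simpa using h
      · intro a ha
        simp at ha ⊢
        omega
      · intro a ha h
        simp at ha h
        by_cases hau : a < u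
        · simp [Nat.choose_eq_zero_of_lt hau]
        · have := h (a - u)
          have h3 : u + t + w - a < t := by omega
          simp [Nat.choose_eq_zero_of_lt h3]
      · intro a ha
        simp at ha
        rw [show u + t + w - (u + a) = t + (w - a) by omega]
    rw [← h1]
    have h2 : ∀ a, ((γ.choose (u + a) : ℝ) * ((u + a).choose u : ℝ)) *
        ((δ.choose (t + (w - a)) : ℝ) * ((t + (w - a)).choose t : ℝ))
        = (γ.choose u : ℝ) * (δ.choose t : ℝ) *
          (((γ - u).choose a : ℝ) * ((δ - t).choose (w - a) : ℝ)) := by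
      intro a
      have e1 := choose_mul_sub γ u a
      have e2 := choose_mul_sub δ t (w - a)
      have e1' : (γ.choose (u + a) : ℝ) * ((u + a).choose u : ℝ)
        = γ.choose u * (γ - u).choose a := by exact_mod_cast e1
      have e2' : (δ.choose (t + (w - a)) : ℝ) * ((t + (w - a)).choose t : ℝ)
        = δ.choose t * (δ - t).choose (w - a) := by exact_mod_cast e2
      rw [e1', e2']; ring
    simp_rw [h2]
    rw [← Finset.mul_sum, ← vand1]
    by_cases hu : u ≤ γ
    · by_cases ht : t ≤ δ
      · have e := choose_mul_sub (γ + δ) (u + t) w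
        have e' : ((γ + δ).choose (u + t + w) : ℝ) * ((u + t + w).choose (u + t) : ℝ)
          = (γ + δ).choose (u + t) * (γ + δ - (u + t)).choose w := by exact_mod_cast e
        rw [show γ - u + (δ - t) = γ + δ - (u + t) by omega]
        have hp : ((γ + δ).choose (u + t) : ℝ) ≠ 0 := by
          have := Nat.choose_pos (show u + t ≤ γ + δ by omega)
          positivity
        rw [dChoose, if_pos ⟨hut, hn⟩, mul_assoc]
        congr 1
        field_simp
        linarith
      · simp [Nat.choose_eq_zero_of_lt (not_le.mp ht)]
    · simp [Nat.choose_eq_zero_of_lt (not_le.mp hu)]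
  · rw [dChoose, if_neg (by tauto)]
    symm
    simp only [mul_zero, zero_mul]
    apply Finset.sum_eq_zero
    intro a ha
    by_cases hau : a < u
    · simp [Nat.choose_eq_zero_of_lt hau]
    · have h3 : n - a < t := by have := Finset.mem_range.mp ha; omega
      simp [Nat.choose_eq_zero_of_lt h3]

lemma hyp_mul (γ δ a n : ℕ) (hn : n ≤ γ + δ) :
    hypW a n γ δ * ((γ + δ).choose n : ℝ) = (γ.choose a : ℝ) * (δ.choose (n - a) : ℝ) := by
  have := Nat.choose_pos hn
  rw [hypW]
  field_simp

lemma d_mul (γ δ b i k : ℕ) (hk : k ≤ γ + δ) :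
    (γ.choose b : ℝ) * (δ.choose i : ℝ) * (dChoose (γ + δ) k (b + i) * ((γ + δ).choose k : ℝ))
    = (γ.choose b : ℝ) * (δ.choose i : ℝ) * ((b + i).choose k : ℝ) := by
  have := Nat.choose_pos hk
  by_cases hb : b ≤ γ
  · by_cases hi : i ≤ δ
    · congr 1
      rw [dChoose]
      split_ifs with h
      · field_simp
      · rw [Nat.choose_eq_zero_of_lt (by omega : b + i < k)]; simp
    · simp [Nat.choose_eq_zero_of_lt (not_le.mp hi)]
  · simp [Nat.choose_eq_zero_of_lt (not_le.mp hb)]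

/-- For positive integers `γ, δ₁, δ₂`, the restricted immediate exchange model
RIEM(γ,δ₁;γ,δ₂) is self-dual with self-duality function
`D(k₁,k₂;n₁,n₂) = d_{γ+δ₁}(k₁,n₁)·d_{γ+δ₂}(k₂,n₂)`. -/
theorem RIEM_selfDual (γ δ₁ δ₂ : ℕ) (hγ : 0 < γ) (hδ₁ : 0 < δ₁) (hδ₂ : 0 < δ₂)
    (k₁ k₂ n₁ n₂ : ℕ) (hk₁ : k₁ ≤ γ + δ₁) (hk₂ : k₂ ≤ γ + δ₂)
    (hn₁ : n₁ ≤ γ + δ₁) (hn₂ : n₂ ≤ γ + δ₂) :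
    PiRIEM γ δ₁ δ₂
        (fun m => dChoose (γ + δ₁) m.1 n₁ * dChoose (γ + δ₂) m.2 n₂) (k₁, k₂)
      = PiRIEM γ δ₁ δ₂
          (fun m => dChoose (γ + δ₁) k₁ m.1 * dChoose (γ + δ₂) k₂ m.2) (n₁, n₂) := by

  have p1 := Nat.choose_pos hk₁
  have p2 := Nat.choose_pos hk₂
  have p3 := Nat.choose_pos hn₁
  have p4 := Nat.choose_pos hn₂
  have hP : (((γ + δ₁).choose k₁ : ℝ) * ((γ + δ₂).choose k₂ : ℝ) *
      (((γ + δ₁).choose n₁ : ℝ) * ((γ + δ₂).choose n₂ : ℝ))) ≠ 0 := by positivity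
  apply mul_right_cancel₀ hP
  let T : ℕ → ℕ → ℕ → ℕ → ℝ := fun s u a b =>
    (((γ.choose a : ℝ) * (a.choose u : ℝ)) *
        ((δ₁.choose (n₁ - a) : ℝ) * ((n₁ - a).choose (k₁ - s) : ℝ))) *
    (((γ.choose b : ℝ) * (b.choose s : ℝ)) *
        ((δ₂.choose (n₂ - b) : ℝ) * ((n₂ - b).choose (k₂ - u) : ℝ)))
  trans ∑ s ∈ Finset.range (k₁ + 1), ∑ u ∈ Finset.range (k₂ + 1),
      ∑ a ∈ Finset.range (n₁ + 1), ∑ b ∈ Finset.range (n₂ + 1), T s u a b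
  · simp only [PiRIEM, Finset.sum_mul]
    refine Finset.sum_congr rfl fun s hs => Finset.sum_congr rfl fun u hu => ?_
    simp only [Finset.mem_range] at hs hu
    simp only [T]
    rw [← Finset.sum_mul_sum, ← vand2 γ δ₁ u (k₁ - s) n₁ hn₁, ← vand2 γ δ₂ s (k₂ - u) n₂ hn₂,
      show u + k₁ - s = u + (k₁ - s) by omega, show s + k₂ - u = s + (k₂ - u) by omega]
    have e1 := hyp_mul γ δ₁ s k₁ hk₁
    have e2 := hyp_mul γ δ₂ u k₂ hk₂
    calc _ = (hypW s k₁ γ δ₁ * ((γ + δ₁).choose k₁ : ℝ)) *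
          (hypW u k₂ γ δ₂ * ((γ + δ₂).choose k₂ : ℝ)) *
          (dChoose (γ + δ₁) (u + (k₁ - s)) n₁ * dChoose (γ + δ₂) (s + (k₂ - u)) n₂ *
          (((γ + δ₁).choose n₁ : ℝ) * ((γ + δ₂).choose n₂ : ℝ))) := by ring
      _ = _ := by rw [e1, e2]; ring
  · symm
    simp only [PiRIEM, Finset.sum_mul]
    trans ∑ a ∈ Finset.range (n₁ + 1), ∑ b ∈ Finset.range (n₂ + 1),
      ∑ s ∈ Finset.range (k₁ + 1), ∑ u ∈ Finset.range (k₂ + 1), T s u a b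
    · refine Finset.sum_congr rfl fun a ha => Finset.sum_congr rfl fun b hb => ?_
      simp only [Finset.mem_range] at ha hb
      rw [show b + n₁ - a = b + (n₁ - a) by omega, show a + n₂ - b = a + (n₂ - b) by omega]
      have e1 := hyp_mul γ δ₁ a n₁ hn₁
      have e2 := hyp_mul γ δ₂ b n₂ hn₂
      have f1 := d_mul γ δ₁ b (n₁ - a) k₁ hk₁
      have f2 := d_mul γ δ₂ a (n₂ - b) k₂ hk₂
      calc _ = (hypW a n₁ γ δ₁ * ((γ + δ₁).choose n₁ : ℝ)) *
          (hypW b n₂ γ δ₂ * ((γ + δ₂).choose n₂ : ℝ)) *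
          ((dChoose (γ + δ₁) k₁ (b + (n₁ - a)) * ((γ + δ₁).choose k₁ : ℝ)) *
          (dChoose (γ + δ₂) k₂ (a + (n₂ - b)) * ((γ + δ₂).choose k₂ : ℝ))) := by ring
        _ = ((γ.choose b : ℝ) * (δ₁.choose (n₁ - a) : ℝ) *
              (dChoose (γ + δ₁) k₁ (b + (n₁ - a)) * ((γ + δ₁).choose k₁ : ℝ))) *
            ((γ.choose a : ℝ) * (δ₂.choose (n₂ - b) : ℝ) *
              (dChoose (γ + δ₂) k₂ (a + (n₂ - b)) * ((γ + δ₂).choose k₂ : ℝ))) := by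
            rw [e1, e2]; ring
        _ = (γ.choose b : ℝ) * (δ₁.choose (n₁ - a) : ℝ) * (γ.choose a : ℝ) *
            (δ₂.choose (n₂ - b) : ℝ) * (((b + (n₁ - a)).choose k₁ : ℝ) *
              ((a + (n₂ - b)).choose k₂ : ℝ)) := by
            rw [f1, f2]; ring
        _ = _ := by
            rw [vand1, vand1, Finset.sum_mul_sum, Finset.mul_sum]
            refine Finset.sum_congr rfl fun s _ => ?_
            rw [Finset.mul_sum]
            refine Finset.sum_congr rfl fun u _ => ?_
            simp only [T]
            ring
    · rw [Finset.sum_congr rfl fun a _ => Finset.sum_comm, Finset.sum_comm]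
      refine Finset.sum_congr rfl fun s _ => ?_
      rw [Finset.sum_congr rfl fun a _ => Finset.sum_comm, Finset.sum_comm]
end

section
/- The transition operator Π of the immediate exchange model based on independent random walkers is self-dual with self-duality function D(k₁,k₂;n₁,n₂) = (n₁!·n₂!)/((n₁−k₁)!·(n₂−k₂)!) if k₁ ≤ n₁ and k₂ ≤ n₂, and D(k₁,k₂;n₁,n₂) = 0 otherwise. -/
/-- The transition operator of the immediate exchange model based on independent random
walkers: `(Πf)(n₁,n₂) = 2^{-n₁-n₂} ∑_{k₁=0}^{n₁} ∑_{k₂=0}^{n₂} C(n₁,k₁)·C(n₂,k₂)·f(k₂+n₁-k₁, k₁+n₂-k₂)`. -/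
noncomputable def PiRW (f : ℕ × ℕ → ℝ) : ℕ × ℕ → ℝ := fun p =>
  (1 / (2 : ℝ) ^ (p.1 + p.2)) *
    ∑ k₁ ∈ Finset.range (p.1 + 1), ∑ k₂ ∈ Finset.range (p.2 + 1),
      (p.1.choose k₁ : ℝ) * (p.2.choose k₂ : ℝ) * f (k₂ + p.1 - k₁, k₁ + p.2 - k₂)

/-- The self-duality function `D(k₁,k₂;n₁,n₂) = n₁!·n₂!/((n₁-k₁)!·(n₂-k₂)!)` for
`k₁ ≤ n₁`, `k₂ ≤ n₂`, and `0` otherwise. -/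
noncomputable def Drw (k n : ℕ × ℕ) : ℝ :=
  if k.1 ≤ n.1 ∧ k.2 ≤ n.2 then
    ((n.1.factorial : ℝ) * n.2.factorial) / ((n.1 - k.1).factorial * (n.2 - k.2).factorial)
  else 0

open Finset in
theorem aux_conv (a b : ℕ) (g : ℕ → ℝ) :
    ∑ j ∈ range (a + 1), ∑ k ∈ range (b + 1), (a.choose j : ℝ) * (b.choose k : ℝ) * g (j + k)
      = ∑ m ∈ range (a + b + 1), ((a + b).choose m : ℝ) * g m := by
  induction a generalizing g with
  | zero => simp
  | succ a ih =>
    have h1 := Finset.sum_choose_succ_mul (R := ℝ)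
      (fun j _ => ∑ k ∈ range (b + 1), (b.choose k : ℝ) * g (j + k)) a
    have h2 := Finset.sum_choose_succ_mul (R := ℝ) (fun j _ => g j) (a + b)
    have e : a + 1 + b = a + b + 1 := by omega
    rw [e, h2, ← ih g, ← ih (fun m => g (m + 1))]
    simp only [Finset.mul_sum, ← mul_assoc] at h1
    rw [h1]
    congr 1
    all_goals
      refine sum_congr rfl fun j _ => sum_congr rfl fun k _ => ?_
      try rw [add_right_comm]

open Finset in
theorem aux_Pi (f : ℕ × ℕ → ℝ) (a b : ℕ) :
    PiRW f (a, b) = (1 / (2 : ℝ) ^ (a + b)) *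
      ∑ m ∈ range (a + b + 1), ((a + b).choose m : ℝ) * f (m, a + b - m) := by
  unfold PiRW
  dsimp only
  congr 1
  rw [← aux_conv a b (fun m => f (m, a + b - m)),
    ← Finset.sum_range_reflect _ (a + 1)]
  refine sum_congr rfl fun j hj => sum_congr rfl fun k hk => ?_
  simp only [mem_range] at hj hk
  have e : a + 1 - 1 - j = a - j := by omega
  rw [e, Nat.choose_symm (by omega)]
  congr 3 <;> omega

theorem aux_D (k n : ℕ × ℕ) :
    Drw k n = ((n.1.descFactorial k.1 * n.2.descFactorial k.2 : ℕ) : ℝ) := by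
  unfold Drw
  split_ifs with h
  · rw [← Nat.factorial_mul_descFactorial h.1, ← Nat.factorial_mul_descFactorial h.2]
    have h1 : ((n.1 - k.1).factorial : ℝ) ≠ 0 := by exact_mod_cast Nat.factorial_ne_zero _
    have h2 : ((n.2 - k.2).factorial : ℝ) ≠ 0 := by exact_mod_cast Nat.factorial_ne_zero _
    push_cast
    field_simp
  · rw [not_and_or, not_le, not_le] at h
    rcases h with h | h <;> simp [Nat.descFactorial_of_lt h]

open Finset in
theorem aux_L (a b K : ℕ) :
    ∑ m ∈ range (K + 1), K.choose m * (a.descFactorial m * b.descFactorial (K - m))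
      = (a + b).descFactorial K := by
  rw [Nat.descFactorial_eq_factorial_mul_choose, Nat.add_choose_eq,
    Finset.Nat.sum_antidiagonal_eq_sum_range_succ_mk, mul_sum]
  refine sum_congr rfl fun m hm => ?_
  simp only [mem_range] at hm
  rw [← Nat.choose_mul_factorial_mul_factorial (show m ≤ K by omega),
    Nat.descFactorial_eq_factorial_mul_choose, Nat.descFactorial_eq_factorial_mul_choose]
  ring

open Finset in
theorem aux_step (N k : ℕ) (g : ℕ → ℕ) :
    ∑ m ∈ range (N + 1 + 1), (N + 1).choose m * (m.descFactorial (k + 1) * g (N + 1 - m))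
      = (N + 1) * ∑ m ∈ range (N + 1), N.choose m * (m.descFactorial k * g (N - m)) := by
  rw [sum_range_succ', mul_sum]
  simp only [Nat.zero_descFactorial_succ, zero_mul, mul_zero, add_zero]
  refine sum_congr rfl fun m hm => ?_
  rw [Nat.succ_descFactorial_succ, Nat.add_sub_add_right]
  have := Nat.add_one_mul_choose_eq N m
  calc _ = ((N + 1).choose (m + 1) * (m + 1)) * (m.descFactorial k * g (N - m)) := by ring
    _ = _ := by rw [← this]; ring

open Finset in
theorem aux_R (k₁ k₂ N : ℕ) :
    2 ^ (k₁ + k₂) * ∑ m ∈ range (N + 1),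
        N.choose m * (m.descFactorial k₁ * (N - m).descFactorial k₂)
      = N.descFactorial (k₁ + k₂) * 2 ^ N := by
  induction k₁ generalizing N with
  | zero =>
    have key : ∀ k N : ℕ, 2 ^ k * ∑ m ∈ range (N + 1), N.choose m * (m.descFactorial k * 1)
        = N.descFactorial k * 2 ^ N := by
      intro k
      induction k with
      | zero => intro N; simp [Nat.sum_range_choose]
      | succ k ih =>
        intro N
        cases N with
        | zero => simp
        | succ N =>
          rw [aux_step N k (fun _ => 1), Nat.succ_descFactorial_succ, pow_succ, pow_succ]
          calc _ = 2 * (N + 1) * (2 ^ k * ∑ m ∈ range (N + 1),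
                    N.choose m * (m.descFactorial k * 1)) := by ring
            _ = _ := by rw [ih]; ring
    rw [zero_add, ← key k₂ N, ← Finset.sum_range_reflect _ (N + 1)]
    congr 1
    refine sum_congr rfl fun m hm => ?_
    simp only [mem_range] at hm
    have e : N + 1 - 1 - m = N - m := by omega
    have e' : N - (N - m) = m := by omega
    rw [e, Nat.choose_symm (by omega), e']
    simp
  | succ k ih =>
    have e : k + 1 + k₂ = k + k₂ + 1 := by omega
    cases N with
    | zero => simp [e]
    | succ N =>
      rw [aux_step N k (fun j => j.descFactorial k₂), e, Nat.succ_descFactorial_succ,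
        pow_succ, pow_succ]
      calc _ = 2 * (N + 1) * (2 ^ (k + k₂) * ∑ m ∈ range (N + 1),
                N.choose m * (m.descFactorial k * (N - m).descFactorial k₂)) := by ring
        _ = _ := by rw [ih]; ring

/-- The immediate exchange model based on independent random walkers is self-dual with
self-duality function `D(k₁,k₂;n₁,n₂) = n₁!·n₂!/((n₁-k₁)!·(n₂-k₂)!)`. -/
theorem RW_selfDual : IsSelfDual PiRW Drw := by
  rintro ⟨k₁, k₂⟩ ⟨n₁, n₂⟩
  rw [aux_Pi, aux_Pi]
  simp only [aux_D]
  have hL := aux_L n₁ n₂ (k₁ + k₂)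
  have hR := aux_R k₁ k₂ (n₁ + n₂)
  rw [← hL] at hR
  have hR' := congrArg (Nat.cast : ℕ → ℝ) hR
  push_cast at hR' ⊢
  simp only [← mul_assoc] at hR' ⊢
  field_simp
  linarith
end

section
/- Let q₁, q₂ > 0 and let Π be the transition operator of the Poissonian immediate exchange model PIEM(q₁,q₂). Then for every λ > 0, the product of the Poisson(λ(1+q₁)) and Poisson(λ(1+q₂)) distributions is reversible for Π: for all finitely supported f, g : ℕ² → ℝ, ∑_{(n₁,n₂) ∈ ℕ²} (Πf)(n₁,n₂)·g(n₁,n₂)·ρ_{λ(1+q₁)}(n₁)·ρ_{λ(1+q₂)}(n₂) = ∑_{(n₁,n₂) ∈ ℕ²} f(n₁,n₂)·(Πg)(n₁,n₂)·ρ_{λ(1+q₁)}(n₁)·ρ_{λ(1+q₂)}(n₂), where ρ_θ(n) = e^{−θ}·θⁿ/n! is the Poisson weight with parameter θ > 0. -/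
/-- The transition operator of the Poissonian immediate exchange model PIEM(q₁,q₂), where
mass is split according to independent Binomial(n_i, 1/(1+q_i)) random variables:
`(Πf)(n₁,n₂) = ∑_{k₁,k₂} C(n₁,k₁)p₁^{k₁}(1-p₁)^{n₁-k₁} C(n₂,k₂)p₂^{k₂}(1-p₂)^{n₂-k₂}
f(k₂+n₁-k₁, k₁+n₂-k₂)` with `p_i = 1/(1+q_i)`. -/
noncomputable def PiPIEM (q₁ q₂ : ℝ) (f : ℕ × ℕ → ℝ) : ℕ × ℕ → ℝ := fun p =>
  ∑ k₁ ∈ Finset.range (p.1 + 1), ∑ k₂ ∈ Finset.range (p.2 + 1),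
    ((p.1.choose k₁ : ℝ) * (1 / (1 + q₁)) ^ k₁ * (1 - 1 / (1 + q₁)) ^ (p.1 - k₁)) *
      ((p.2.choose k₂ : ℝ) * (1 / (1 + q₂)) ^ k₂ * (1 - 1 / (1 + q₂)) ^ (p.2 - k₂)) *
      f (k₂ + p.1 - k₁, k₁ + p.2 - k₂)

/-- The Poisson weight `ρ_θ(n) = e^{-θ}·θⁿ/n!`. -/
noncomputable def poissonW (θ : ℝ) (n : ℕ) : ℝ := Real.exp (-θ) * θ ^ n / n.factorial

noncomputable def piemW (q₁ q₂ lam : ℝ) (z : (ℕ × ℕ) × (ℕ × ℕ)) : ℝ :=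
  (Real.exp (-(lam * (1 + q₁))) * lam ^ z.1.1 * (lam * q₁) ^ z.1.2
    / (z.1.1.factorial * z.1.2.factorial)) *
  (Real.exp (-(lam * (1 + q₂))) * lam ^ z.2.1 * (lam * q₂) ^ z.2.2
    / (z.2.1.factorial * z.2.2.factorial))

lemma piem_weight (q lam : ℝ) (hq : 0 < q) (k a : ℕ) :
    (((k + a).choose k : ℝ) * (1 / (1 + q)) ^ k * (1 - 1 / (1 + q)) ^ a)
      * poissonW (lam * (1 + q)) (k + a)
    = Real.exp (-(lam * (1 + q))) * lam ^ k * (lam * q) ^ a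
      / (k.factorial * a.factorial) := by
  have h1 : (1 + q) ≠ 0 := by positivity
  have h2 : (1 - 1 / (1 + q)) = q / (1 + q) := by field_simp; ring
  have hc : ((k + a).choose k : ℝ) * k.factorial * a.factorial = (k + a).factorial := by
    have h := Nat.choose_mul_factorial_mul_factorial (Nat.le_add_right k a)
    rw [Nat.add_sub_cancel_left] at h
    exact_mod_cast h
  have f1 : (k.factorial : ℝ) ≠ 0 := by positivity
  have f2 : (a.factorial : ℝ) ≠ 0 := by positivity
  have f3 : ((k + a).choose k : ℝ) ≠ 0 := by
    have := Nat.choose_pos (Nat.le_add_right k a)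
    positivity
  unfold poissonW
  rw [h2, ← hc, div_pow, div_pow, mul_pow, mul_pow, pow_add, pow_add, one_pow]
  field_simp

lemma piem_fiber (F : (ℕ × ℕ) × (ℕ × ℕ) → ℝ) (hF : Summable F) :
    ∑' n : ℕ × ℕ, ∑ x ∈ Finset.HasAntidiagonal.antidiagonal n.1, ∑ y ∈ Finset.HasAntidiagonal.antidiagonal n.2, F (x, y)
      = ∑' z, F z := by
  have h := hF.hasSum.tsum_fiberwise
    (fun z : (ℕ × ℕ) × (ℕ × ℕ) => (z.1.1 + z.1.2, z.2.1 + z.2.2))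
  rw [← h.tsum_eq]
  refine tsum_congr fun n => ?_
  have hs : ((fun z : (ℕ × ℕ) × (ℕ × ℕ) => (z.1.1 + z.1.2, z.2.1 + z.2.2)) ⁻¹' {n})
      = ↑(Finset.HasAntidiagonal.antidiagonal n.1 ×ˢ Finset.HasAntidiagonal.antidiagonal n.2) := by
    ext z
    simp [Prod.ext_iff]
  rw [hs, Finset.tsum_subtype', Finset.sum_product]

lemma piem_key (q₁ q₂ lam : ℝ) (hq₁ : 0 < q₁) (hq₂ : 0 < q₂)
    (f g : ℕ × ℕ → ℝ) (hg : (Function.support g).Finite) :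
    ∑' n : ℕ × ℕ, PiPIEM q₁ q₂ f n * g n
        * (poissonW (lam * (1 + q₁)) n.1 * poissonW (lam * (1 + q₂)) n.2)
      = ∑' z : (ℕ × ℕ) × (ℕ × ℕ), piemW q₁ q₂ lam z * f (z.2.1 + z.1.2, z.1.1 + z.2.2)
          * g (z.1.1 + z.1.2, z.2.1 + z.2.2) := by
  rw [← piem_fiber]
  · refine tsum_congr fun n => ?_
    obtain ⟨n, m⟩ := n
    unfold PiPIEM
    simp only
    rw [← Finset.Nat.sum_antidiagonal_eq_sum_range_succ (fun k a =>
      ∑ k₂ ∈ Finset.range (m + 1),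
    ((n.choose k : ℝ) * (1 / (1 + q₁)) ^ k * (1 - 1 / (1 + q₁)) ^ a) *
      ((m.choose k₂ : ℝ) * (1 / (1 + q₂)) ^ k₂ * (1 - 1 / (1 + q₂)) ^ (m - k₂)) *
      f (k₂ + n - k, k + m - k₂)) n, Finset.sum_mul, Finset.sum_mul]
    refine Finset.sum_congr rfl fun x hx => ?_
    rw [← Finset.Nat.sum_antidiagonal_eq_sum_range_succ (fun k a =>
    ((n.choose x.1 : ℝ) * (1 / (1 + q₁)) ^ x.1 * (1 - 1 / (1 + q₁)) ^ x.2) *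
      ((m.choose k : ℝ) * (1 / (1 + q₂)) ^ k * (1 - 1 / (1 + q₂)) ^ a) *
      f (k + n - x.1, x.1 + m - k)) m, Finset.sum_mul, Finset.sum_mul]
    refine Finset.sum_congr rfl fun y hy => ?_
    obtain ⟨k, a⟩ := x
    obtain ⟨l, b⟩ := y
    simp only [Finset.HasAntidiagonal.mem_antidiagonal] at hx hy
    subst hx hy
    simp only [piemW]
    rw [← piem_weight q₁ lam hq₁, ← piem_weight q₂ lam hq₂,
      show l + (k + a) - k = l + a by omega, show k + (l + b) - l = k + b by omega]
    ring
  · apply summable_of_hasFiniteSupport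
    refine Set.Finite.subset (Set.Finite.preimage' hg
      (f := fun z : (ℕ × ℕ) × (ℕ × ℕ) => (z.1.1 + z.1.2, z.2.1 + z.2.2)) ?_) ?_
    · intro n _
      refine (Finset.finite_toSet
        (Finset.HasAntidiagonal.antidiagonal n.1 ×ˢ Finset.HasAntidiagonal.antidiagonal n.2)).subset ?_
      intro z
      simp [Prod.ext_iff]
    · intro z hz
      simp only [Function.mem_support, Set.mem_preimage] at hz ⊢
      exact right_ne_zero_of_mul hz

def piemSwap : (ℕ × ℕ) × (ℕ × ℕ) ≃ (ℕ × ℕ) × (ℕ × ℕ) where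
  toFun z := ((z.2.1, z.1.2), (z.1.1, z.2.2))
  invFun z := ((z.2.1, z.1.2), (z.1.1, z.2.2))
  left_inv _ := rfl
  right_inv _ := rfl

/-- For `q₁, q₂ > 0` and `λ > 0`, the product of the Poisson(λ(1+q₁)) and Poisson(λ(1+q₂))
distributions is reversible for the transition operator of PIEM(q₁,q₂). -/
theorem PIEM_reversible (q₁ q₂ lam : ℝ) (hq₁ : 0 < q₁) (hq₂ : 0 < q₂) (hlam : 0 < lam)
    (f g : ℕ × ℕ → ℝ) (hf : (Function.support f).Finite) (hg : (Function.support g).Finite) :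
    ∑' n : ℕ × ℕ, PiPIEM q₁ q₂ f n * g n
        * (poissonW (lam * (1 + q₁)) n.1 * poissonW (lam * (1 + q₂)) n.2)
      = ∑' n : ℕ × ℕ, f n * PiPIEM q₁ q₂ g n
          * (poissonW (lam * (1 + q₁)) n.1 * poissonW (lam * (1 + q₂)) n.2) := by
  have h2 : ∀ n : ℕ × ℕ, f n * PiPIEM q₁ q₂ g n
          * (poissonW (lam * (1 + q₁)) n.1 * poissonW (lam * (1 + q₂)) n.2)
      = PiPIEM q₁ q₂ g n * f n
          * (poissonW (lam * (1 + q₁)) n.1 * poissonW (lam * (1 + q₂)) n.2) := fun n => by ring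
  simp_rw [h2]
  rw [piem_key q₁ q₂ lam hq₁ hq₂ f g hg, piem_key q₁ q₂ lam hq₁ hq₂ g f hf,
    ← piemSwap.tsum_eq]
  refine tsum_congr fun z => ?_
  simp only [piemSwap, Equiv.coe_fn_mk, piemW]
  ring
end
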